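/- arXiv:2308.11987 — 2 statements merged into one kernel-verified Lean document; each statement's English description precedes it below -/
import Mathlib

section
/- For every B ≥ 1 there exist constants 0 < c₁(B) < c₂(B) and an absolute constant x₀ such that: if x ≥ x₀, 1 ≤ y ≤ x with Log₂ x − Log₂ y ≥ 2B², and k is a positive integer with |k − 2·(Log₂ x − Log₂ y)| ≤ B·√(Log₂ x − Log₂ y), then c₁(B) · (Log x)/(2^k · Log y · √(Log₂ x − Log₂ y)) ≤ ∏_{y ≤ p < x}(1 + 1/p)^{-1} · ∑_{n ∈ S_{[y,x)}, ω(n) = k} 1/n ≤ c₂(B) · (Log x)/(2^k · Log y · √(Log₂ x − Log₂ y)). -/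
open Filter Topology
open scoped Classical

noncomputable def LLog (x : ℝ) : ℝ := max 1 (Real.log x)
noncomputable def LLog2 (x : ℝ) : ℝ := LLog (LLog x)
noncomputable def LLog3 (x : ℝ) : ℝ := LLog (LLog2 x)

/-- `Δ^{(v)}(n)`: the maximal number of divisors of `n` in an interval `(e^u, e^{u+v}]`. -/
noncomputable def DeltaV (v : ℝ) (n : ℕ) : ℕ :=
  ⨆ u : ℝ, (n.divisors.filter fun d => Real.exp u < (d : ℝ) ∧ (d : ℝ) ≤ Real.exp (u + v)).card

/-- The Erdős–Hooley Delta function. -/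
noncomputable def Delta (n : ℕ) : ℕ := DeltaV 1 n

/-- `S_{[y,x)}`: squarefree positive integers all of whose prime factors `p` satisfy `y ≤ p < x`. -/
def Sset (y x : ℝ) : Set ℕ :=
  {n | 0 < n ∧ Squarefree n ∧ ∀ p ∈ n.primeFactors, y ≤ (p : ℝ) ∧ (p : ℝ) < x}

/-- `∏_{y ≤ p < x} (1 + 1/p)⁻¹`, product over primes. -/
noncomputable def primeProd (y x : ℝ) : ℝ :=
  ∏ᶠ p ∈ {p : ℕ | p.Prime ∧ y ≤ (p : ℝ) ∧ (p : ℝ) < x}, ((1 : ℝ) + 1 / p)⁻¹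

/-- number of distinct prime factors -/
def omegaN (n : ℕ) : ℕ := n.primeFactors.card

/-- number of divisors -/
def tauN (n : ℕ) : ℕ := n.divisors.card

/-- `n_{<y}`: the largest divisor of `n` (squarefree) composed of primes `< y`. -/
noncomputable def nsmall (n : ℕ) (y : ℝ) : ℕ :=
  ∏ p ∈ n.primeFactors.filter (fun p : ℕ => (p : ℝ) < y), p

def Yset (α x : ℝ) : Set ℝ :=
  {y | 0 < y ∧ |LLog2 y - α * LLog2 x| ≤ Real.sqrt (LLog2 x) ∧ ∃ m : ℤ, LLog2 y = m * Real.log 2}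

def Uset (α x : ℝ) : Set ℤ :=
  {u | |(u : ℝ) - (Real.log 4 - 1) / Real.log 2 * (α * LLog2 x)| ≤ Real.sqrt (LLog2 x)}

noncomputable def Qfun (t : ℝ) : ℝ := t * Real.log t - t + 1


/-- primes at most `n` -/
def prL (n : ℕ) : Finset ℕ := (Finset.range (n + 1)).filter Nat.Prime

noncomputable def Mf (n : ℕ) : ℝ := ∑ p ∈ prL n, Real.log p / p
noncomputable def Ff (n : ℕ) : ℝ := ∑ p ∈ prL n, (1 : ℝ) / p

lemma mem_prL {n p : ℕ} : p ∈ prL n ↔ p ≤ n ∧ p.Prime := by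
  simp [prL]

lemma log_factorial_eq (n : ℕ) :
    Real.log (n.factorial : ℝ) = ∑ p ∈ prL n, (padicValNat p n.factorial : ℝ) * Real.log p := by
  rw [Real.log_nat_eq_sum_factorization]
  rw [Finsupp.sum_of_support_subset (s := prL n)]
  · apply Finset.sum_congr rfl
    intro p hp
    rw [Nat.factorization_def _ (mem_prL.1 hp).2]
  · intro p hp
    rw [Nat.support_factorization] at hp
    have h1 := Nat.prime_of_mem_primeFactors hp
    have h2 := Nat.dvd_of_mem_primeFactors hp
    exact mem_prL.2 ⟨(h1.dvd_factorial).1 h2, h1⟩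
  · intro i _
    simp

lemma val_lower {n p : ℕ} (hp : p.Prime) : (n : ℝ) / p - 1 ≤ padicValNat p n.factorial := by
  have := Fact.mk hp
  have h : n / p ≤ padicValNat p n.factorial := by
    rw [padicValNat_factorial (b := Nat.log p n + 2) (by omega)]
    have := Finset.single_le_sum (f := fun i => n / p ^ i) (s := Finset.Ico 1 (Nat.log p n + 2))
      (fun i _ => Nat.zero_le _) (a := 1) (by simp)
    simpa using this
  have h3 : (n : ℝ) / p < (n / p : ℕ) + 1 := by
    have := Nat.lt_floor_add_one ((n : ℝ) / p)
    rwa [Nat.floor_div_natCast, Nat.floor_natCast] at this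
  have h4 : ((n / p : ℕ) : ℝ) ≤ padicValNat p n.factorial := by exact_mod_cast h
  linarith

lemma val_upper {n p : ℕ} (hp : p.Prime) :
    (padicValNat p n.factorial : ℝ) ≤ (n : ℝ) / p + n / (p * (p - 1)) := by
  have := Fact.mk hp
  have h := sub_one_mul_padicValNat_factorial (p := p) n
  have h2 : (p - 1) * padicValNat p n.factorial ≤ n := by rw [h]; omega
  have hp2 : (2 : ℝ) ≤ p := by exact_mod_cast hp.two_le
  have h3 : ((p : ℝ) - 1) * padicValNat p n.factorial ≤ n := by
    have : (((p - 1 : ℕ) : ℝ)) * padicValNat p n.factorial ≤ n := by exact_mod_cast h2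
    rwa [Nat.cast_sub hp.one_lt.le, Nat.cast_one] at this
  have h4 : (n : ℝ) / p + n / (p * (p - 1)) = n / (p - 1) := by
    have : (p : ℝ) - 1 ≠ 0 := by linarith
    field_simp
    ring
  rw [h4, le_div_iff₀ (by linarith)]
  linarith

lemma theta_le (n : ℕ) : ∑ p ∈ prL n, Real.log p ≤ Real.log 4 * n := by
  have h := Chebyshev.theta_le_log4_mul_x (x := (n : ℝ)) (by positivity)
  rw [Chebyshev.theta_eq_sum_Icc, Nat.floor_natCast] at h
  convert h using 2
  ext p
  simp [prL]

lemma logsum_bdd : ∃ C : ℝ, 0 ≤ C ∧ ∀ n : ℕ, ∑ p ∈ prL n, Real.log p / (p * (p - 1)) ≤ C := by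
  have hs : Summable (fun n : ℕ => 4 * (1 / (n : ℝ) ^ (3/2 : ℝ))) :=
    (Real.summable_one_div_nat_rpow.2 (by norm_num)).mul_left 4
  refine ⟨∑' n : ℕ, 4 * (1 / (n : ℝ) ^ (3/2 : ℝ)), tsum_nonneg fun n => by positivity, fun n => ?_⟩
  refine le_trans (Finset.sum_le_sum ?_) (hs.sum_le_tsum (prL n) (fun i _ => by positivity))
  intro p hp
  have hp2 : (2 : ℝ) ≤ p := by exact_mod_cast (mem_prL.1 hp).2.two_le
  have h1 : Real.log p ≤ (p : ℝ) ^ (1/2 : ℝ) / (1/2) := Real.log_le_rpow_div (by linarith) (by norm_num)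
  have h2 : (p : ℝ) ^ (1/2 : ℝ) * (p : ℝ) ^ (3/2 : ℝ) = p ^ 2 := by
    rw [← Real.rpow_add (by linarith), ← Real.rpow_natCast]; norm_num
  have h3 : 0 < (p : ℝ) ^ (3/2 : ℝ) := by positivity
  have h4 : 0 < (p : ℝ) * (p - 1) := by nlinarith
  rw [mul_one_div, div_le_div_iff₀ h4 h3]
  have : Real.log p * (p : ℝ) ^ (3/2 : ℝ) ≤ 2 * p ^ 2 := by
    rw [← h2]; nlinarith
  nlinarith

lemma mertens1 : ∃ C : ℝ, 1 ≤ C ∧ ∀ n : ℕ, 1 ≤ n → |Mf n - Real.log n| ≤ C := by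
  obtain ⟨C, hC, h⟩ := logsum_bdd
  refine ⟨C + 1 + Real.log 4, by have := Real.log_nonneg (show (1:ℝ) ≤ 4 by norm_num); linarith, fun n hn => ?_⟩
  have hl4 := Real.log_nonneg (show (1:ℝ) ≤ 4 by norm_num)
  have hn' : (0 : ℝ) < n := by exact_mod_cast hn
  have e := log_factorial_eq n
  have hlog : ∀ p ∈ prL n, 0 ≤ Real.log (p : ℝ) := fun p _ => Real.log_natCast_nonneg p
  have lo : n * Mf n - Real.log 4 * n ≤ Real.log (n.factorial : ℝ) := by
    have : n * Mf n - ∑ p ∈ prL n, Real.log p ≤ Real.log (n.factorial : ℝ) := by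
      rw [e, Mf, Finset.mul_sum, ← Finset.sum_sub_distrib]
      apply Finset.sum_le_sum
      intro p hp
      have := mul_le_mul_of_nonneg_right (val_lower (n := n) (mem_prL.1 hp).2) (hlog p hp)
      calc _ = ((n : ℝ) / p - 1) * Real.log p := by ring
        _ ≤ _ := this
    linarith [theta_le n]
  have hi : Real.log (n.factorial : ℝ) ≤ n * Mf n + n * C := by
    have : Real.log (n.factorial : ℝ) ≤ n * Mf n + n * ∑ p ∈ prL n, Real.log p / (p * (p - 1)) := by
      rw [e, Mf, Finset.mul_sum, Finset.mul_sum, ← Finset.sum_add_distrib]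
      apply Finset.sum_le_sum
      intro p hp
      have := mul_le_mul_of_nonneg_right (val_upper (n := n) (mem_prL.1 hp).2) (hlog p hp)
      calc _ ≤ _ := this
        _ = _ := by ring
    nlinarith [h n]
  have f1 : Real.log (n.factorial : ℝ) ≤ n * Real.log n := by
    rw [← Real.log_pow]
    apply Real.log_le_log (by positivity)
    exact_mod_cast Nat.factorial_le_pow n
  have f2 : n * Real.log n - n ≤ Real.log (n.factorial : ℝ) := by
    have := Stirling.le_log_factorial_stirling (n := n) (by omega)
    have h1 := Real.log_natCast_nonneg n
    have h2 : 0 ≤ Real.log (2 * Real.pi) := Real.log_nonneg (by linarith [Real.pi_gt_three])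
    linarith
  rw [abs_le]
  constructor
  · have : n * (Real.log n - 1 - C) ≤ n * Mf n := by linarith
    have := le_of_mul_le_mul_left this hn'
    linarith
  · have : n * Mf n ≤ n * (Real.log n + Real.log 4) := by linarith
    have := le_of_mul_le_mul_left this hn'
    linarith

lemma prL_succ_sum (f : ℕ → ℝ) (n : ℕ) :
    ∑ p ∈ prL (n + 1), f p = ∑ p ∈ prL n, f p + if (n + 1).Prime then f (n + 1) else 0 := by
  simp only [prL, Finset.sum_filter]
  rw [Finset.sum_range_succ]

/-- step inequality -/
lemma D_step (n : ℕ) (hn : 2 ≤ n) :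
    (Ff (n + 1) - Mf (n + 1) / Real.log (n + 1 : ℕ)) - (Ff n - Mf n / Real.log n)
      = Mf n * (1 / Real.log n - 1 / Real.log (n + 1 : ℕ)) := by
  have h : 0 < Real.log (n + 1 : ℕ) := Real.log_pos (by exact_mod_cast (by omega : 1 < n + 1))
  have h' : 0 < Real.log n := Real.log_pos (by exact_mod_cast (by omega : 1 < n))
  unfold Ff Mf
  rw [prL_succ_sum (fun p => 1 / (p : ℝ)), prL_succ_sum (fun p => Real.log p / (p : ℝ))]
  split_ifs with hp
  · have : ((n + 1 : ℕ) : ℝ) ≠ 0 := by positivity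
    field_simp
    ring
  · ring

lemma step_bounds (a b : ℝ) (ha : 0 < a) (hab : a ≤ b) (hb : b ≤ a + 1) (M C : ℝ) (hM : |M - a| ≤ C) :
    M * (1 / a - 1 / b) ≤ Real.log b - Real.log a + C * (1 / a - 1 / b) ∧
    Real.log b - Real.log a - (C + 1) * (1 / a - 1 / b) ≤ M * (1 / a - 1 / b) := by
  have hb0 : 0 < b := by linarith
  have hd : 0 ≤ 1 / a - 1 / b := by
    have := one_div_le_one_div_of_le ha hab; linarith
  obtain ⟨h1, h2⟩ := abs_le.1 hM
  have e1 : a * (1 / a - 1 / b) = 1 - a / b := by field_simp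
  have l1 : Real.log a - Real.log b ≤ a / b - 1 := by
    rw [← Real.log_div ha.ne' hb0.ne']; exact Real.log_le_sub_one_of_pos (by positivity)
  have l2 : Real.log b - Real.log a ≤ b / a - 1 := by
    rw [← Real.log_div hb0.ne' ha.ne']; exact Real.log_le_sub_one_of_pos (by positivity)
  have e2 : b / a - 1 = (1 - a / b) + (b - a) * (1 / a - 1 / b) := by field_simp; ring
  constructor
  · nlinarith
  · nlinarith

lemma mertens2 : ∃ C : ℝ, 1 ≤ C ∧ ∀ n : ℕ, 2 ≤ n → |Ff n - Real.log (Real.log n)| ≤ C := by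
  obtain ⟨C, hC, h⟩ := mertens1
  set D : ℕ → ℝ := fun n => Ff n - Mf n / Real.log n with hD
  have key : ∀ n : ℕ, 2 ≤ n →
      D n - Real.log (Real.log n) + C / Real.log n ≤ D 2 - Real.log (Real.log 2) + C / Real.log 2 ∧
      D 2 - Real.log (Real.log 2) - (C + 1) / Real.log 2 ≤ D n - Real.log (Real.log n) - (C + 1) / Real.log n := by
    intro n hn
    induction n, hn using Nat.le_induction with
    | base => simp
    | succ n hn ih =>
      have hs := D_step n hn
      have h' : 0 < Real.log n := Real.log_pos (by exact_mod_cast (by omega : 1 < n))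
      have hn0 : (0 : ℝ) < n := by positivity
      have hle : Real.log n ≤ Real.log (n + 1 : ℕ) := Real.log_le_log hn0 (by push_cast; linarith)
      have hle1 : Real.log (n + 1 : ℕ) ≤ Real.log n + 1 := by
        have : Real.log (n + 1 : ℕ) ≤ Real.log (n * Real.exp 1) := by
          apply Real.log_le_log (by positivity)
          have : (2 : ℝ) ≤ Real.exp 1 := by have := Real.add_one_le_exp 1; linarith
          have h1 : (1 : ℝ) ≤ n := by exact_mod_cast (by omega)
          push_cast; nlinarith
        rwa [Real.log_mul hn0.ne' (Real.exp_ne_zero _), Real.log_exp] at this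
      obtain ⟨s1, s2⟩ := step_bounds _ _ h' hle hle1 (Mf n) C (h n (by omega))
      have e1 : C / Real.log n = C * (1 / Real.log n) := by ring
      have e2 : C / Real.log (n + 1 : ℕ) = C * (1 / Real.log (n + 1 : ℕ)) := by ring
      have e3 : (C + 1) / Real.log n = (C + 1) * (1 / Real.log n) := by ring
      have e4 : (C + 1) / Real.log (n + 1 : ℕ) = (C + 1) * (1 / Real.log (n + 1 : ℕ)) := by ring
      simp only [hD] at ih ⊢
      rw [e1, e3] at ih
      rw [e2, e4]
      constructor
      · linarith [ih.1]
      · linarith [ih.2]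
  have hl2 : 0 < Real.log 2 := Real.log_pos (by norm_num)
  refine ⟨|D 2 - Real.log (Real.log 2)| + (C + 1) / Real.log 2 + 1 + C / Real.log 2 + 1, ?_, ?_⟩
  · have : 0 ≤ (C + 1) / Real.log 2 := by positivity
    have : 0 ≤ C / Real.log 2 := by positivity
    linarith [abs_nonneg (D 2 - Real.log (Real.log 2))]
  · intro n hn
    obtain ⟨k1, k2⟩ := key n hn
    have h' : Real.log 2 ≤ Real.log n := Real.log_le_log (by norm_num) (by exact_mod_cast hn)
    have hn0 : 0 < Real.log n := by linarith
    have hr : |Mf n / Real.log n - 1| ≤ C / Real.log 2 := by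
      have : Mf n / Real.log n - 1 = (Mf n - Real.log n) / Real.log n := by field_simp
      rw [this, abs_div, abs_of_pos hn0]
      exact div_le_div₀ (by linarith) (h n (by omega)) hl2 h'
    have p1 : 0 ≤ (C + 1) / Real.log n := by positivity
    have p2 : 0 ≤ C / Real.log n := by positivity
    have p3 : C / Real.log 2 ≤ (C + 1) / Real.log 2 := by gcongr; linarith
    obtain ⟨r1, r2⟩ := abs_le.1 hr
    simp only [hD] at k1 k2 ⊢
    have a1 := le_abs_self (Ff 2 - Mf 2 / Real.log (2 : ℕ) - Real.log (Real.log 2))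
    have a2 := neg_abs_le (Ff 2 - Mf 2 / Real.log (2 : ℕ) - Real.log (Real.log 2))
    rw [abs_le]
    constructor <;> linarith

/-- elementary symmetric sum -/
noncomputable def es (w : ℕ → ℝ) (s : Finset ℕ) (k : ℕ) : ℝ :=
  ∑ t ∈ Finset.powersetCard k s, ∏ p ∈ t, w p

lemma es_zero (w : ℕ → ℝ) (s : Finset ℕ) : es w s 0 = 1 := by simp [es]

lemma es_empty_succ (w : ℕ → ℝ) (k : ℕ) : es w ∅ (k + 1) = 0 := by
  rw [es, Finset.powersetCard_eq_empty.2 (by simp), Finset.sum_empty]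

lemma es_insert (w : ℕ → ℝ) (s : Finset ℕ) (a : ℕ) (ha : a ∉ s) (k : ℕ) :
    es w (insert a s) (k + 1) = es w s (k + 1) + w a * es w s k := by
  unfold es
  rw [Finset.powersetCard_succ_insert ha, Finset.sum_union, Finset.sum_image, Finset.mul_sum]
  · congr 1
    apply Finset.sum_congr rfl
    intro t ht
    rw [Finset.prod_insert]
    intro h
    exact ha ((Finset.mem_powersetCard.1 ht).1 h)
  · intro t ht u hu htu
    have h1 : a ∉ t := fun h => ha ((Finset.mem_powersetCard.1 ht).1 h)
    have h2 : a ∉ u := fun h => ha ((Finset.mem_powersetCard.1 hu).1 h)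
    have := congrArg (fun v => Finset.erase v a) htu
    simpa [Finset.erase_insert h1, Finset.erase_insert h2] using this
  · rw [Finset.disjoint_left]
    intro t ht hu
    obtain ⟨u, _, rfl⟩ := Finset.mem_image.1 hu
    exact ha ((Finset.mem_powersetCard.1 ht).1 (Finset.mem_insert_self _ _))

lemma es_nonneg (w : ℕ → ℝ) (hw : ∀ p, 0 ≤ w p) (s : Finset ℕ) (k : ℕ) : 0 ≤ es w s k :=
  Finset.sum_nonneg fun _ _ => Finset.prod_nonneg fun p _ => hw p

lemma es_mono (w : ℕ → ℝ) (hw : ∀ p, 0 ≤ w p) {s t : Finset ℕ} (h : s ⊆ t) (k : ℕ) :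
    es w s k ≤ es w t k :=
  Finset.sum_le_sum_of_subset_of_nonneg (Finset.powersetCard_mono h)
    fun _ _ _ => Finset.prod_nonneg fun p _ => hw p

lemma es_one (w : ℕ → ℝ) (s : Finset ℕ) : es w s 1 = ∑ p ∈ s, w p := by
  induction s using Finset.induction_on with
  | empty => simp [es_empty_succ]
  | insert a s ha ih => rw [es_insert w s a ha 0, ih, es_zero, Finset.sum_insert ha]; ring

lemma es_upper_step (w : ℕ → ℝ) (hw : ∀ p, 0 ≤ w p) (s : Finset ℕ) :
    ∀ k : ℕ, (k + 1 : ℝ) * es w s (k + 1) ≤ (∑ p ∈ s, w p) * es w s k := by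
  induction s using Finset.induction_on with
  | empty => intro k; simp [es_empty_succ]
  | insert a s ha ih =>
    intro k
    rw [Finset.sum_insert ha, es_insert w s a ha]
    cases k with
    | zero => rw [es_zero, es_zero, zero_add, es_one]; simp; linarith
    | succ k =>
      rw [es_insert w s a ha]
      have h1 := ih (k + 1)
      have h2 := mul_le_mul_of_nonneg_left (ih k) (hw a)
      have h3 : 0 ≤ w a * (w a * es w s k) := mul_nonneg (hw a) (mul_nonneg (hw a) (es_nonneg w hw s k))
      push_cast at *
      linarith

lemma es_upper (w : ℕ → ℝ) (hw : ∀ p, 0 ≤ w p) (s : Finset ℕ) (k : ℕ) :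
    es w s k ≤ (∑ p ∈ s, w p) ^ k / k.factorial := by
  rw [le_div_iff₀ (by positivity)]
  induction k with
  | zero => simp [es_zero]
  | succ k ih =>
    have h := es_upper_step w hw s k
    have hP : 0 ≤ ∑ p ∈ s, w p := Finset.sum_nonneg fun p _ => hw p
    have h2 := mul_le_mul_of_nonneg_left ih hP
    have h3 := mul_le_mul_of_nonneg_right h (by positivity : (0:ℝ) ≤ k.factorial)
    rw [Nat.factorial_succ, pow_succ]
    push_cast
    linarith

lemma es_lower_step (w : ℕ → ℝ) (hw : ∀ p, 0 ≤ w p) (s : Finset ℕ) :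
    ∀ k : ℕ, (∑ p ∈ s, w p) * es w s (k + 1) ≤
      (k + 2 : ℝ) * es w s (k + 2) + (∑ p ∈ s, w p ^ 2) * es w s k := by
  induction s using Finset.induction_on with
  | empty => intro k; simp [es_empty_succ]
  | insert a s ha ih =>
    intro k
    rw [Finset.sum_insert ha, Finset.sum_insert ha, es_insert w s a ha, es_insert w s a ha]
    have h1 := ih k
    cases k with
    | zero =>
      rw [es_zero, es_zero]
      rw [es_zero] at h1
      rw [zero_add] at *
      have := es_one w s
      rw [← this] at h1 ⊢
      push_cast at *
      nlinarith
    | succ k =>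
      rw [es_insert w s a ha]
      have h2 := mul_le_mul_of_nonneg_left (ih k) (hw a)
      have h3 : 0 ≤ w a * (w a * (w a * es w s k)) :=
        mul_nonneg (hw a) (mul_nonneg (hw a) (mul_nonneg (hw a) (es_nonneg w hw s k)))
      push_cast at *
      linarith

lemma es_lower (w : ℕ → ℝ) (hw : ∀ p, 0 ≤ w p) (s : Finset ℕ) (k : ℕ) :
    (∑ p ∈ s, w p) ^ (k + 2) - ((k + 2) * (k + 1) / 2) * (∑ p ∈ s, w p ^ 2) * (∑ p ∈ s, w p) ^ k
      ≤ (k + 2).factorial * es w s (k + 2) := by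
  have hP : 0 ≤ ∑ p ∈ s, w p := Finset.sum_nonneg fun p _ => hw p
  have hQ : 0 ≤ ∑ p ∈ s, w p ^ 2 := Finset.sum_nonneg fun p _ => sq_nonneg _
  induction k with
  | zero =>
    have h := es_lower_step w hw s 0
    rw [es_zero, zero_add, es_one] at h
    simp at *
    nlinarith
  | succ k ih =>
    have h := es_lower_step w hw s (k + 1)
    have hu := es_upper w hw s (k + 1)
    rw [le_div_iff₀ (by positivity)] at hu
    have h2 := mul_le_mul_of_nonneg_left ih hP
    have h3 := mul_le_mul_of_nonneg_right h (by positivity : (0:ℝ) ≤ (k + 2).factorial)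
    have h4 := mul_le_mul_of_nonneg_left hu (mul_nonneg (by positivity : (0:ℝ) ≤ k + 2) hQ)
    have f1 : ((k + 2).factorial : ℝ) = (k + 2) * (k + 1).factorial := by
      rw [Nat.factorial_succ (k + 1)]; push_cast; ring
    have f2 : ((k + 1 + 2).factorial : ℝ) = (k + 3) * (k + 2).factorial := by
      rw [show k + 1 + 2 = (k + 2) + 1 by ring, Nat.factorial_succ (k + 2)]; push_cast; ring
    rw [f2]
    rw [show k + 1 + 1 = k + 2 by ring] at h3
    have h5 : (∑ p ∈ s, w p ^ 2) * es w s (k + 1) * (k + 2).factorial ≤ (k + 2) * (∑ p ∈ s, w p ^ 2) * (∑ p ∈ s, w p) ^ (k + 1) := by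
      rw [f1]
      calc _ = (k + 2) * (∑ p ∈ s, w p ^ 2) * (es w s (k + 1) * (k + 1).factorial) := by ring
        _ ≤ _ := h4
    push_cast at *
    rw [pow_succ] at *
    ring_nf at *
    linarith

lemma es_good (w : ℕ → ℝ) (hw : ∀ p, 0 ≤ w p) (s : Finset ℕ) (k : ℕ) (hk : 2 ≤ k)
    (h : (k : ℝ) ^ 2 * ∑ p ∈ s, w p ^ 2 ≤ (∑ p ∈ s, w p) ^ 2) :
    (∑ p ∈ s, w p) ^ k / (2 * k.factorial) ≤ es w s k := by
  obtain ⟨m, rfl⟩ := Nat.exists_eq_add_of_le' hk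
  have hP : 0 ≤ ∑ p ∈ s, w p := Finset.sum_nonneg fun p _ => hw p
  have hQ : 0 ≤ ∑ p ∈ s, w p ^ 2 := Finset.sum_nonneg fun p _ => sq_nonneg _
  have hl := es_lower w hw s m
  rw [div_le_iff₀ (by positivity)]
  have h1 : ((m + 2) * (m + 1) / 2) * (∑ p ∈ s, w p ^ 2) ≤ (∑ p ∈ s, w p) ^ 2 / 2 := by
    push_cast at h
    have hm : (0 : ℝ) ≤ m := by positivity
    have : ((m : ℝ) + 2) * (m + 1) * (∑ p ∈ s, w p ^ 2) ≤ (m + 2) ^ 2 * (∑ p ∈ s, w p ^ 2) := by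
      apply mul_le_mul_of_nonneg_right _ hQ
      nlinarith
    linarith
  have h2 := mul_le_mul_of_nonneg_right h1 (pow_nonneg hP m)
  have h3 : (∑ p ∈ s, w p) ^ 2 / 2 * (∑ p ∈ s, w p) ^ m = (∑ p ∈ s, w p) ^ (m + 2) / 2 := by ring
  linarith

lemma fact_upper (k : ℕ) (hk : 1 ≤ k) :
    (k.factorial : ℝ) ≤ Real.exp 1 * Real.sqrt k * (k / Real.exp 1) ^ k := by
  have h := Stirling.stirlingSeq'_antitone (Nat.zero_le (k - 1))
  simp only [Function.comp] at h
  rw [show (k - 1).succ = k by omega, show Nat.succ 0 = 1 from rfl, Stirling.stirlingSeq_one,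
    Stirling.stirlingSeq] at h
  have hk0 : (0 : ℝ) < k := by exact_mod_cast hk
  rw [div_le_iff₀ (by positivity)] at h
  refine h.trans (le_of_eq ?_)
  rw [Real.sqrt_mul (by norm_num)]
  have : Real.sqrt 2 ≠ 0 := by positivity
  field_simp

lemma pow_ratio (k : ℕ) (hk : 1 ≤ k) (L : ℝ) (hL : 0 < L) :
    L ^ k / (k / Real.exp 1) ^ k = Real.exp (k * (1 + Real.log (2 * L / k))) / 2 ^ k := by
  have hk0 : (0 : ℝ) < k := by exact_mod_cast hk
  rw [Real.exp_nat_mul, Real.exp_add, Real.exp_log (by positivity), ← div_pow, ← div_pow]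
  congr 1
  field_simp

lemma stir_upper (k : ℕ) (hk : 1 ≤ k) (L : ℝ) (hL : 0 < L) (hLk : L ≤ k) :
    L ^ k / k.factorial ≤ Real.exp (2 * L) / (2 ^ k * Real.sqrt L) := by
  have hk0 : (0 : ℝ) < k := by exact_mod_cast hk
  have h := Stirling.le_factorial_stirling k
  have h1 : Real.sqrt L ≤ Real.sqrt (2 * Real.pi * k) := by
    apply Real.sqrt_le_sqrt; nlinarith [Real.pi_gt_three]
  have hsL : 0 < Real.sqrt L := Real.sqrt_pos.2 hL
  have hp : 0 < (k / Real.exp 1) ^ k := by positivity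
  have h2 : Real.sqrt L * (k / Real.exp 1) ^ k ≤ k.factorial :=
    le_trans (mul_le_mul_of_nonneg_right h1 hp.le) h
  calc L ^ k / k.factorial ≤ L ^ k / (Real.sqrt L * (k / Real.exp 1) ^ k) := by gcongr
    _ = (L ^ k / (k / Real.exp 1) ^ k) / Real.sqrt L := by field_simp
    _ = Real.exp (k * (1 + Real.log (2 * L / k))) / 2 ^ k / Real.sqrt L := by rw [pow_ratio k hk L hL]
    _ ≤ Real.exp (2 * L) / 2 ^ k / Real.sqrt L := by
      have := Real.log_le_sub_one_of_pos (show 0 < 2 * L / k by positivity)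
      apply div_le_div_of_nonneg_right _ hsL.le
      apply div_le_div_of_nonneg_right _ (by positivity)
      apply Real.exp_le_exp.2
      calc k * (1 + Real.log (2 * L / k)) ≤ k * (2 * L / k) := mul_le_mul_of_nonneg_left (by linarith) hk0.le
        _ = 2 * L := by field_simp
    _ = _ := by rw [div_div]

lemma stir_lower (k : ℕ) (hk : 1 ≤ k) (L B : ℝ) (hL : 0 < L) (hLk : (k : ℝ) ≤ 4 * L)
    (hB : |(k : ℝ) - 2 * L| ≤ B * Real.sqrt L) :
    Real.exp (-(B ^ 2 / 2) - 1) / 2 * (Real.exp (2 * L) / (2 ^ k * Real.sqrt L)) ≤ L ^ k / k.factorial := by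
  have hk0 : (0 : ℝ) < k := by exact_mod_cast hk
  have hsL : 0 < Real.sqrt L := Real.sqrt_pos.2 hL
  have hp : 0 < (k / Real.exp 1) ^ k := by positivity
  have h1 : Real.sqrt k ≤ 2 * Real.sqrt L := by
    rw [show (2 : ℝ) = Real.sqrt 4 by rw [show (4:ℝ) = 2 ^ 2 by norm_num, Real.sqrt_sq (by norm_num)],
      ← Real.sqrt_mul (by norm_num)]
    exact Real.sqrt_le_sqrt hLk
  have h2 : (k.factorial : ℝ) ≤ Real.exp 1 * (2 * Real.sqrt L) * (k / Real.exp 1) ^ k :=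
    (fact_upper k hk).trans (by gcongr)
  have hsq : ((k : ℝ) - 2 * L) ^ 2 ≤ B ^ 2 * L := by
    have := pow_le_pow_left₀ (abs_nonneg _) hB 2
    rwa [sq_abs, mul_pow, Real.sq_sqrt hL.le] at this
  have h3 : 2 * L - B ^ 2 / 2 ≤ k * (1 + Real.log (2 * L / k)) := by
    have := Real.one_sub_inv_le_log_of_pos (show 0 < 2 * L / k by positivity)
    have h4 : k * (2 - (2 * L / k)⁻¹) ≤ k * (1 + Real.log (2 * L / k)) := by gcongr; linarith
    refine le_trans ?_ h4
    have h5 : k * (2 - (2 * L / k)⁻¹) = 2 * L - ((k : ℝ) - 2 * L) ^ 2 / (2 * L) := by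
      field_simp; ring
    rw [h5]
    have : ((k : ℝ) - 2 * L) ^ 2 / (2 * L) ≤ B ^ 2 / 2 := by
      rw [div_le_iff₀ (by positivity)]; linarith
    linarith
  calc _ = Real.exp (2 * L - B ^ 2 / 2) / 2 ^ k / (Real.exp 1 * (2 * Real.sqrt L)) := by
        rw [show 2 * L - B ^ 2 / 2 = (-(B ^ 2 / 2) - 1) + 2 * L + 1 by ring, Real.exp_add, Real.exp_add]
        field_simp
    _ ≤ Real.exp (k * (1 + Real.log (2 * L / k))) / 2 ^ k / (Real.exp 1 * (2 * Real.sqrt L)) := by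
        gcongr
    _ = (L ^ k / (k / Real.exp 1) ^ k) / (Real.exp 1 * (2 * Real.sqrt L)) := by rw [pow_ratio k hk L hL]
    _ = L ^ k / (Real.exp 1 * (2 * Real.sqrt L) * (k / Real.exp 1) ^ k) := by rw [div_div, mul_comm]
    _ ≤ _ := by gcongr

noncomputable def ps (y x : ℝ) : Finset ℕ :=
  (Finset.range ⌈x⌉₊).filter (fun p => p.Prime ∧ y ≤ (p : ℝ))

lemma mem_ps {y x : ℝ} {p : ℕ} : p ∈ ps y x ↔ p.Prime ∧ y ≤ (p : ℝ) ∧ (p : ℝ) < x := by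
  simp only [ps, Finset.mem_filter, Finset.mem_range, Nat.lt_ceil]
  tauto

lemma primeProd_eq (y x : ℝ) : primeProd y x = ∏ p ∈ ps y x, ((1 : ℝ) + 1 / p)⁻¹ := by
  unfold primeProd
  rw [← finprod_mem_coe_finset]
  apply finprod_mem_congr
  · ext p
    simp [mem_ps]
  · intros; rfl

lemma sum_eq_es (y x : ℝ) (k : ℕ) :
    ∑ᶠ n ∈ {n | n ∈ Sset y x ∧ omegaN n = k}, ((n : ℝ))⁻¹ = es (fun p => 1 / (p : ℝ)) (ps y x) k := by
  have hpr : ∀ t ∈ Finset.powersetCard k (ps y x), ∀ p ∈ t, p.Prime := fun t ht p hp =>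
    (mem_ps.1 ((Finset.mem_powersetCard.1 ht).1 hp)).1
  have hinj : Set.InjOn (fun t : Finset ℕ => ∏ p ∈ t, p) (Finset.powersetCard k (ps y x) : Set (Finset ℕ)) := by
    intro t ht u hu h
    have h1 := Nat.primeFactors_prod (hpr t ht)
    have h2 := Nat.primeFactors_prod (hpr u hu)
    simp only at h
    rw [← h1, ← h2, h]
  have hset : {n | n ∈ Sset y x ∧ omegaN n = k} =
      ((Finset.powersetCard k (ps y x)).image (fun t : Finset ℕ => ∏ p ∈ t, p) : Set ℕ) := by
    ext n
    simp only [Set.mem_ofPred_eq, Finset.coe_image, Set.mem_image, Finset.mem_coe, Sset, omegaN]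
    constructor
    · rintro ⟨⟨h0, hs, hp⟩, hk⟩
      refine ⟨n.primeFactors, Finset.mem_powersetCard.2 ⟨?_, hk⟩, Nat.prod_primeFactors_of_squarefree hs⟩
      intro p hpp
      exact mem_ps.2 ⟨Nat.prime_of_mem_primeFactors hpp, hp p hpp⟩
    · rintro ⟨t, ht, rfl⟩
      have h1 := Nat.primeFactors_prod (hpr t ht)
      rw [h1]
      refine ⟨⟨Finset.prod_pos fun p hp => (hpr t ht p hp).pos, ?_, ?_⟩, (Finset.mem_powersetCard.1 ht).2⟩
      · refine Finset.squarefree_prod_of_pairwise_isCoprime (fun p hp q hq hpq => ?_)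
          (fun p hp => (hpr t ht p hp).squarefree)
        exact Nat.coprime_iff_isRelPrime.1 ((Nat.coprime_primes (hpr t ht p hp) (hpr t ht q hq)).2 hpq)
      · intro p hp
        exact (mem_ps.1 ((Finset.mem_powersetCard.1 ht).1 hp)).2
  rw [hset, finsum_mem_coe_finset, Finset.sum_image hinj]
  unfold es
  apply Finset.sum_congr rfl
  intro t _
  push_cast
  simp

lemma ps_sum (f : ℕ → ℝ) {y x : ℝ} (hy : 1 ≤ y) (hxy : y ≤ x) :
    ∑ p ∈ ps y x, f p = ∑ p ∈ prL (⌈x⌉₊ - 1), f p - ∑ p ∈ prL (⌈y⌉₊ - 1), f p := by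
  have hx1 : 1 ≤ ⌈x⌉₊ := Nat.one_le_ceil_iff.2 (by linarith)
  have hy1 : 1 ≤ ⌈y⌉₊ := Nat.one_le_ceil_iff.2 (by linarith)
  have hle : ⌈y⌉₊ ≤ ⌈x⌉₊ := Nat.ceil_mono hxy
  have hps : ps y x = prL (⌈x⌉₊ - 1) \ prL (⌈y⌉₊ - 1) := by
    ext p
    rw [Finset.mem_sdiff, mem_prL, mem_prL, mem_ps, ← Nat.lt_ceil, ← Nat.ceil_le]
    constructor
    · rintro ⟨h1, h2, h3⟩
      exact ⟨⟨by omega, h1⟩, by rintro ⟨h, _⟩; omega⟩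
    · rintro ⟨⟨h1, h2⟩, h3⟩
      refine ⟨h2, ?_, by omega⟩
      by_contra h
      exact h3 ⟨by omega, h2⟩
  rw [hps, Finset.sum_sdiff_eq_sub]
  intro p hp
  rw [mem_prL] at *
  exact ⟨by omega, hp.2⟩

lemma LLog_one_le (x : ℝ) : 1 ≤ LLog x := le_max_left _ _
lemma LLog2_one_le (x : ℝ) : 1 ≤ LLog2 x := LLog_one_le _
lemma log_le_LLog (x : ℝ) : Real.log x ≤ LLog x := le_max_right _ _

lemma LLog_mono {x y : ℝ} (hx : 0 < x) (h : x ≤ y) : LLog x ≤ LLog y :=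
  max_le_max le_rfl (Real.log_le_log hx h)

lemma LLog2_mono {x y : ℝ} (hx : 0 < x) (h : x ≤ y) : LLog2 x ≤ LLog2 y :=
  LLog_mono (by linarith [LLog_one_le x]) (LLog_mono hx h)

lemma LLog2_expexp {v : ℝ} (hv : 1 ≤ v) : LLog2 (Real.exp (Real.exp v)) = v := by
  unfold LLog2 LLog
  rw [Real.log_exp, max_eq_right (by linarith [Real.add_one_le_exp v] : 1 ≤ Real.exp v), Real.log_exp,
    max_eq_right hv]

lemma LLog_le_exp (x : ℝ) : LLog x ≤ Real.exp (LLog2 x) := by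
  have h : 0 < LLog x := by linarith [LLog_one_le x]
  calc LLog x = Real.exp (Real.log (LLog x)) := (Real.exp_log h).symm
    _ ≤ _ := Real.exp_le_exp.2 (log_le_LLog _)

lemma LLog_eq_exp {x : ℝ} (hx : 1 < LLog2 x) : LLog x = Real.exp (LLog2 x) := by
  have h : 0 < LLog x := by linarith [LLog_one_le x]
  have e : LLog2 x = max 1 (Real.log (LLog x)) := rfl
  rw [e] at hx ⊢
  rcases lt_max_iff.1 hx with h1 | h1
  · exact absurd h1 (lt_irrefl _)
  · rw [max_eq_right h1.le]
    exact (Real.exp_log h).symm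

lemma exp_le_LLog (x : ℝ) : Real.exp (LLog2 x - 1) ≤ LLog x := by
  have h : 0 < LLog x := by linarith [LLog_one_le x]
  rcases (LLog2_one_le x).eq_or_lt with h1 | h1
  · rw [← h1]; simpa using LLog_one_le x
  · rw [LLog_eq_exp h1]; exact Real.exp_le_exp.2 (by linarith)

lemma ceil_facts {t : ℝ} (ht : 3 < t) :
    3 ≤ ⌈t⌉₊ - 1 ∧ ((⌈t⌉₊ - 1 : ℕ) : ℝ) ≤ t ∧ t ≤ ((⌈t⌉₊ - 1 : ℕ) : ℝ) + 1 := by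
  have h4 : 3 < ⌈t⌉₊ := Nat.lt_ceil.2 (by exact_mod_cast ht)
  have h1 := Nat.le_ceil t
  have h2 := Nat.ceil_lt_add_one (show 0 ≤ t by linarith)
  refine ⟨by omega, ?_, ?_⟩ <;> rw [Nat.cast_sub (by omega)] <;> push_cast <;> linarith

lemma small_ceil {t : ℝ} (ht : t ≤ 3) : ⌈t⌉₊ - 1 ≤ 2 := by
  have : ⌈t⌉₊ ≤ 3 := Nat.ceil_le.2 (by exact_mod_cast ht)
  omega

lemma Ff_mono {a b : ℕ} (h : a ≤ b) : Ff a ≤ Ff b := by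
  apply Finset.sum_le_sum_of_subset_of_nonneg
  · intro p hp
    rw [mem_prL] at *
    exact ⟨by omega, hp.2⟩
  · intros; positivity

lemma Ff_LLog2 : ∃ C : ℝ, 1 ≤ C ∧ ∀ t : ℝ, 1 ≤ t → |Ff (⌈t⌉₊ - 1) - LLog2 t| ≤ C := by
  obtain ⟨C, hC, h⟩ := mertens2
  refine ⟨C + 3 + Ff 2, ?_, ?_⟩
  · have : 0 ≤ Ff 2 := Finset.sum_nonneg fun p _ => by positivity
    linarith
  intro t ht
  have hF2 : 0 ≤ Ff 2 := Finset.sum_nonneg fun p _ => by positivity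
  have he := Real.exp_one_gt_d9
  rcases le_or_gt t 3 with h3 | h3
  · have h1 := Ff_mono (small_ceil h3)
    have h0 : 0 ≤ Ff (⌈t⌉₊ - 1) := Finset.sum_nonneg fun p _ => by positivity
    have hl : LLog2 t ≤ 1 := by
      have : t ≤ Real.exp (Real.exp 1) := by
        have := Real.add_one_le_exp (Real.exp 1)
        linarith
      calc LLog2 t ≤ LLog2 (Real.exp (Real.exp 1)) := LLog2_mono (by linarith) this
        _ = 1 := LLog2_expexp le_rfl
    have := LLog2_one_le t
    rw [abs_le]
    constructor <;> linarith
  · obtain ⟨n3, hn1, hn2⟩ := ceil_facts h3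
    set n := ⌈t⌉₊ - 1 with hn
    have hm := h n (by omega)
    have n3' : (3 : ℝ) ≤ n := by exact_mod_cast n3
    have he3 : Real.exp 1 < 3 := by linarith [Real.exp_one_lt_d9]
    have hlogn : 1 ≤ Real.log n := by
      rw [Real.le_log_iff_exp_le (by linarith)]; linarith
    have hlt : Real.log n ≤ Real.log t := Real.log_le_log (by linarith) hn1
    have hlt2 : Real.log t ≤ 2 * Real.log n := by
      have : t ≤ (n : ℝ) ^ 2 := by nlinarith
      calc Real.log t ≤ Real.log ((n : ℝ) ^ 2) := Real.log_le_log (by linarith) this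
        _ = _ := by rw [Real.log_pow]; norm_num
    have hL : LLog t = Real.log t := max_eq_right (by linarith)
    have hll : Real.log (Real.log n) ≤ Real.log (Real.log t) := Real.log_le_log (by linarith) hlt
    have hll2 : Real.log (Real.log t) ≤ 1 + Real.log (Real.log n) := by
      calc _ ≤ Real.log (2 * Real.log n) := Real.log_le_log (by linarith) hlt2
        _ = Real.log 2 + Real.log (Real.log n) := Real.log_mul (by norm_num) (by linarith)
        _ ≤ _ := by linarith [Real.log_two_lt_d9]
    have hnn : 0 ≤ Real.log (Real.log n) := Real.log_nonneg hlogn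
    have b1 : Real.log (Real.log t) ≤ LLog2 t := by rw [LLog2, hL]; exact log_le_LLog _
    have b2 : LLog2 t ≤ Real.log (Real.log t) + 1 := by
      rw [LLog2, hL, LLog]; exact max_le (by linarith) (by linarith)
    obtain ⟨m1, m2⟩ := abs_le.1 hm
    rw [abs_le]
    constructor <;> linarith

lemma P_est : ∃ C : ℝ, 1 ≤ C ∧ ∀ x y : ℝ, 1 ≤ y → y ≤ x →
    |∑ p ∈ ps y x, 1 / (p : ℝ) - (LLog2 x - LLog2 y)| ≤ C := by
  obtain ⟨C, hC, h⟩ := Ff_LLog2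
  refine ⟨2 * C, by linarith, fun x y hy hxy => ?_⟩
  rw [ps_sum (fun p => 1 / (p : ℝ)) hy hxy]
  have h1 := abs_le.1 (h x (by linarith))
  have h2 := abs_le.1 (h y hy)
  unfold Ff at h1 h2
  rw [abs_le]
  constructor <;> linarith [h1.1, h1.2, h2.1, h2.2]

lemma M_est : ∃ C : ℝ, 1 ≤ C ∧ ∀ x y : ℝ, 1 ≤ y → y ≤ x → 3 < x →
    Real.log x - Real.log y - C ≤ ∑ p ∈ ps y x, Real.log p / (p : ℝ) := by
  obtain ⟨C, hC, h⟩ := mertens1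
  refine ⟨2 * C + 1, by linarith, fun x y hy hxy hx => ?_⟩
  rw [ps_sum (fun p => Real.log p / (p : ℝ)) hy hxy]
  have hMx : Real.log x - 1 - C ≤ Mf (⌈x⌉₊ - 1) := by
    obtain ⟨n3, hn1, hn2⟩ := ceil_facts hx
    set n := ⌈x⌉₊ - 1 with hn
    have n3' : (3 : ℝ) ≤ n := by exact_mod_cast n3
    have := abs_le.1 (h n (by omega))
    have hl : Real.log x ≤ Real.log 2 + Real.log n := by
      rw [← Real.log_mul (by norm_num) (by linarith)]
      exact Real.log_le_log (by linarith) (by linarith)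
    linarith [Real.log_two_lt_d9, this.1]
  have hMy : Mf (⌈y⌉₊ - 1) ≤ Real.log y + C := by
    rcases Nat.eq_zero_or_pos (⌈y⌉₊ - 1) with h0 | h0
    · rw [h0]
      have : Mf 0 = 0 := by simp [Mf, prL, Finset.sum_filter]
      rw [this]
      have := Real.log_nonneg hy
      linarith
    · have h1 := abs_le.1 (h _ h0)
      have h2 : ((⌈y⌉₊ - 1 : ℕ) : ℝ) ≤ y := by
        have := Nat.ceil_lt_add_one (show 0 ≤ y by linarith)
        rw [Nat.cast_sub (by omega)]; push_cast; linarith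
      have h3 := Real.log_le_log (by exact_mod_cast h0) h2
      linarith [h1.2]
  unfold Mf at hMx hMy
  linarith

lemma Q_est {y x z : ℝ} (hz : 0 < z) (hzy : z ≤ y) :
    ∑ p ∈ ps y x, (1 / (p : ℝ)) ^ 2 ≤ 2 / z := by
  have hc : 1 ≤ ⌈z⌉₊ := Nat.one_le_ceil_iff.2 hz
  have h := sum_Ioo_inv_sq_le (α := ℝ) (⌈z⌉₊ - 1) ⌈x⌉₊
  have h1 : (((⌈z⌉₊ - 1 : ℕ) : ℝ)) + 1 = ⌈z⌉₊ := by rw [Nat.cast_sub hc]; push_cast; ring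
  rw [h1] at h
  have h2 : (2 : ℝ) / ⌈z⌉₊ ≤ 2 / z := div_le_div_of_nonneg_left (by norm_num) hz (Nat.le_ceil z)
  refine le_trans ?_ (h.trans h2)
  have hsub : ps y x ⊆ Finset.Ioo (⌈z⌉₊ - 1) ⌈x⌉₊ := by
    intro p hp
    rw [mem_ps] at hp
    rw [Finset.mem_Ioo]
    have h3 : ⌈z⌉₊ ≤ p := Nat.ceil_le.2 (hzy.trans hp.2.1)
    exact ⟨by omega, Nat.lt_ceil.2 hp.2.2⟩
  calc _ = ∑ p ∈ ps y x, ((p : ℝ) ^ 2)⁻¹ := Finset.sum_congr rfl fun p _ => by simp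
    _ ≤ _ := Finset.sum_le_sum_of_subset_of_nonneg hsub fun _ _ _ => by positivity

lemma Q_le_one (y x : ℝ) : ∑ p ∈ ps y x, (1 / (p : ℝ)) ^ 2 ≤ 1 := by
  have h := Q_est (y := max y 2) (x := x) (z := 2) (by norm_num) (le_max_right _ _)
  have h2 : ps y x ⊆ ps (max y 2) x := by
    intro p hp
    rw [mem_ps] at *
    exact ⟨hp.1, max_le hp.2.1 (by exact_mod_cast hp.1.two_le), hp.2.2⟩
  refine (Finset.sum_le_sum_of_subset_of_nonneg h2 fun _ _ _ => sq_nonneg _).trans (h.trans ?_)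
  norm_num

lemma primeProd_lower (y x : ℝ) : Real.exp (-∑ p ∈ ps y x, 1 / (p : ℝ)) ≤ primeProd y x := by
  rw [primeProd_eq, ← Finset.sum_neg_distrib, Real.exp_sum]
  apply Finset.prod_le_prod
  · intros; positivity
  · intro p _
    rw [Real.exp_neg]
    apply inv_anti₀ (by positivity)
    linarith [Real.add_one_le_exp (1 / (p : ℝ))]

lemma primeProd_upper (y x : ℝ) : primeProd y x ≤ Real.exp (1 - ∑ p ∈ ps y x, 1 / (p : ℝ)) := by
  have h : primeProd y x ≤ Real.exp (∑ p ∈ ps y x, ((1 / (p : ℝ)) ^ 2 - 1 / (p : ℝ))) := by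
    rw [primeProd_eq, Real.exp_sum]
    apply Finset.prod_le_prod
    · intros; positivity
    · intro p _
      set t := 1 / (p : ℝ) with ht
      have ht0 : 0 ≤ t := by positivity
      have h1 : 0 < 1 + t := by linarith
      rw [← Real.exp_log (inv_pos.2 h1), Real.log_inv]
      apply Real.exp_le_exp.2
      have := Real.one_sub_inv_le_log_of_pos h1
      have h2 : 1 - (1 + t)⁻¹ = t - t ^ 2 + t ^ 3 / (1 + t) := by field_simp; ring
      have : 0 ≤ t ^ 3 / (1 + t) := by positivity
      linarith
  refine h.trans (Real.exp_le_exp.2 ?_)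
  rw [Finset.sum_sub_distrib]
  linarith [Q_le_one y x]

lemma exp_neg_two_le {t : ℝ} (h0 : 0 ≤ t) (h1 : t ≤ 1 / 2) : Real.exp (-(2 * t)) ≤ 1 - t := by
  rw [Real.exp_neg]
  have h := Real.add_one_le_exp (2 * t)
  rw [inv_le_comm₀ (Real.exp_pos _) (by linarith)]
  refine le_trans ?_ h
  rw [inv_le_iff_one_le_mul₀ (by linarith)]
  nlinarith

lemma low_bound : ∃ x₀ c : ℝ, 0 < c ∧ ∀ x y : ℝ, ∀ k : ℕ, x₀ ≤ x → 1 ≤ y → y ≤ x →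
    2 ≤ LLog2 x - LLog2 y → LLog2 x - LLog2 y ≤ k → (k : ℝ) ≤ 3 * (LLog2 x - LLog2 y) →
    c * ((LLog2 x - LLog2 y) ^ k / k.factorial) ≤ es (fun p => 1 / (p : ℝ)) (ps y x) k := by
  obtain ⟨C, hC, hP⟩ := P_est
  obtain ⟨D, hD, hM⟩ := M_est
  have hw : ∀ p : ℕ, 0 ≤ (fun p : ℕ => 1 / (p : ℝ)) p := fun p => by positivity
  set E := C + LLog2 72 with hE
  have hE1 : 1 ≤ E := by linarith [LLog2_one_le 72]
  set L0 := 2 * E with hL0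
  set z := 72 * L0 ^ 2 with hz
  have hz72 : 72 ≤ z := by rw [hz]; nlinarith
  set K := ⌈3 * L0⌉₊ with hK
  refine ⟨max (max (Real.exp (Real.exp (LLog2 z + L0))) (Real.exp (4 * D))) 72,
    min (Real.exp (-(6 * E)) / 2) (1 / (2 * (2 * L0) ^ K)), by positivity, ?_⟩
  intro x y k hx hy hyx hL2 hLk hk3
  have hx72 : 72 ≤ x := (le_max_right _ _).trans hx
  have hxD : Real.exp (4 * D) ≤ x := ((le_max_right _ _).trans (le_max_left _ _)).trans hx
  have hxz : Real.exp (Real.exp (LLog2 z + L0)) ≤ x := ((le_max_left _ _).trans (le_max_left _ _)).trans hx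
  set L := LLog2 x - LLog2 y with hL
  have hL0' : 0 < L := by linarith
  have hk2 : 2 ≤ k := by exact_mod_cast hL2.trans hLk
  rcases le_or_gt L0 L with hc | hc
  · -- large `L`
    have hsub : ps (max y 72) x ⊆ ps y x := by
      intro p hp
      rw [mem_ps] at *
      exact ⟨hp.1, (le_max_left _ _).trans hp.2.1, hp.2.2⟩
    refine le_trans ?_ (es_mono _ hw hsub k)
    have hQ := Q_est (y := max y 72) (x := x) (z := 72) (by norm_num) (le_max_right _ _)
    have hp1 := (abs_le.1 (hP x (max y 72) (hy.trans (le_max_left _ _)) (max_le hyx hx72))).1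
    have hmax : LLog2 (max y 72) ≤ LLog2 y + LLog2 72 := by
      rcases max_choice y 72 with h | h <;> rw [h]
      · linarith [LLog2_one_le 72]
      · linarith [LLog2_one_le y]
    set P := ∑ p ∈ ps (max y 72) x, 1 / (p : ℝ) with hPdef
    have hPL : L - E ≤ P := by linarith
    have hPL2 : L / 2 ≤ P := by linarith
    have hg := es_good (fun p : ℕ => 1 / (p : ℝ)) hw (ps (max y 72) x) k hk2 (by
      have h1 : (k : ℝ) ^ 2 ≤ (3 * L) ^ 2 := pow_le_pow_left₀ (by positivity) hk3 2
      have h2 : (L / 2) ^ 2 ≤ P ^ 2 := pow_le_pow_left₀ (by positivity) hPL2 2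
      have h3 : (k : ℝ) ^ 2 * ∑ p ∈ ps (max y 72) x, (1 / (p : ℝ)) ^ 2 ≤ (3 * L) ^ 2 * (2 / 72) :=
        mul_le_mul h1 hQ (Finset.sum_nonneg fun _ _ => sq_nonneg _) (by positivity)
      refine h3.trans (le_trans (le_of_eq ?_) h2)
      ring)
    refine le_trans ?_ hg
    have hexp : L ^ k * Real.exp (-(6 * E)) ≤ P ^ k := by
      have h1 : L * Real.exp (-(2 * (E / L))) ≤ P := by
        have := exp_neg_two_le (t := E / L) (by positivity) (by rw [div_le_iff₀ hL0']; linarith)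
        calc _ ≤ L * (1 - E / L) := mul_le_mul_of_nonneg_left this hL0'.le
          _ = L - E := by field_simp
          _ ≤ P := hPL
      have h2 := pow_le_pow_left₀ (by positivity) h1 k
      refine le_trans ?_ h2
      rw [mul_pow, ← Real.exp_nat_mul]
      apply mul_le_mul_of_nonneg_left _ (by positivity)
      apply Real.exp_le_exp.2
      have : k * (2 * (E / L)) ≤ 6 * E := by
        calc k * (2 * (E / L)) ≤ (3 * L) * (2 * (E / L)) := by gcongr
          _ = 6 * E := by field_simp; norm_num
      linarith
    calc _ ≤ Real.exp (-(6 * E)) / 2 * (L ^ k / k.factorial) := by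
          gcongr; exact min_le_left _ _
      _ = (L ^ k * Real.exp (-(6 * E))) / (2 * k.factorial) := by field_simp
      _ ≤ P ^ k / (2 * k.factorial) := by gcongr
  · -- bounded `L`
    have hLz : LLog2 z + L0 ≤ LLog2 x := by
      rw [← LLog2_expexp (v := LLog2 z + L0) (by linarith [LLog2_one_le z])]
      exact LLog2_mono (Real.exp_pos _) hxz
    have hzy : z ≤ y := by
      by_contra hcon
      have := LLog2_mono (by linarith) (le_of_not_ge hcon)
      linarith
    have hQ := Q_est (y := y) (x := x) (z := z) (by linarith) hzy
    have hlogx : 4 * D ≤ Real.log x := by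
      rw [Real.le_log_iff_exp_le (by linarith)]; exact hxD
    have hLLx : LLog x = Real.log x := max_eq_right (by linarith)
    have hlogy : Real.log y ≤ Real.log x / 4 := by
      have h1 := (log_le_LLog y).trans (LLog_le_exp y)
      have h2 : Real.exp (LLog2 y) ≤ Real.exp (LLog2 x - 2) := Real.exp_le_exp.2 (by linarith)
      rw [Real.exp_sub, ← LLog_eq_exp (x := x) (by linarith [LLog2_one_le y]), hLLx] at h2
      have h3 : (4 : ℝ) ≤ Real.exp 2 := by
        have h5 : Real.exp 2 = Real.exp 1 ^ 2 := by rw [← Real.exp_nat_mul]; norm_num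
        have := Real.exp_one_gt_d9
        rw [h5]; nlinarith
      have h4 : Real.log x / Real.exp 2 ≤ Real.log x / 4 :=
        div_le_div_of_nonneg_left (by linarith) (by norm_num) h3
      linarith
    have hm := hM x y hy hyx (by linarith)
    set P := ∑ p ∈ ps y x, 1 / (p : ℝ) with hPdef
    have hPx : ∑ p ∈ ps y x, Real.log p / (p : ℝ) ≤ P * Real.log x := by
      rw [hPdef, Finset.sum_mul]
      apply Finset.sum_le_sum
      intro p hp
      have h1 := mem_ps.1 hp
      have hp0 : (0 : ℝ) < p := by exact_mod_cast h1.1.pos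
      have : Real.log p ≤ Real.log x := Real.log_le_log hp0 h1.2.2.le
      calc Real.log p / (p : ℝ) ≤ Real.log x / p := by gcongr
        _ = _ := by ring
    have hPh : 1 / 2 ≤ P := by
      have : 1 / 2 * Real.log x ≤ P * Real.log x := by linarith
      exact le_of_mul_le_mul_right this (by linarith)
    have hkL0 : (k : ℝ) ≤ 3 * L0 := by linarith
    have hg := es_good (fun p : ℕ => 1 / (p : ℝ)) hw (ps y x) k hk2 (by
      have h1 : (k : ℝ) ^ 2 ≤ (3 * L0) ^ 2 := pow_le_pow_left₀ (by positivity) hkL0 2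
      have h2 : (1 / 2) ^ 2 ≤ P ^ 2 := pow_le_pow_left₀ (by positivity) hPh 2
      have h3 : (k : ℝ) ^ 2 * ∑ p ∈ ps y x, (1 / (p : ℝ)) ^ 2 ≤ (3 * L0) ^ 2 * (2 / z) :=
        mul_le_mul h1 hQ (Finset.sum_nonneg fun _ _ => sq_nonneg _) (by positivity)
      refine h3.trans (le_trans (le_of_eq ?_) h2)
      have : L0 ≠ 0 := by linarith
      rw [hz]
      field_simp
      norm_num)
    refine le_trans ?_ hg
    have hkK : k ≤ K := by
      have := hkL0.trans (Nat.le_ceil (3 * L0))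
      exact_mod_cast this
    have hpow : L ^ k ≤ (2 * L0) ^ K * P ^ k := by
      calc L ^ k ≤ ((2 * L0) * P) ^ k := by
            apply pow_le_pow_left₀ hL0'.le
            nlinarith
        _ = (2 * L0) ^ k * P ^ k := mul_pow _ _ _
        _ ≤ (2 * L0) ^ K * P ^ k := by
            gcongr
            linarith
    calc _ ≤ 1 / (2 * (2 * L0) ^ K) * (L ^ k / k.factorial) := by
          gcongr; exact min_le_right _ _
      _ ≤ 1 / (2 * (2 * L0) ^ K) * ((2 * L0) ^ K * P ^ k / k.factorial) := by gcongr
      _ = P ^ k / (2 * k.factorial) := by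
          have : L0 ≠ 0 := by linarith
          field_simp

theorem statement6 :
    ∃ x₀ : ℝ, ∀ B : ℝ, 1 ≤ B → ∃ c₁ c₂ : ℝ, 0 < c₁ ∧ c₁ < c₂ ∧
      ∀ x y : ℝ, ∀ k : ℕ, x₀ ≤ x → 1 ≤ y → y ≤ x →
        2 * B ^ 2 ≤ LLog2 x - LLog2 y → 0 < k →
        |(k : ℝ) - 2 * (LLog2 x - LLog2 y)| ≤ B * Real.sqrt (LLog2 x - LLog2 y) →
        c₁ * LLog x / ((2:ℝ) ^ k * LLog y * Real.sqrt (LLog2 x - LLog2 y))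
            ≤ primeProd y x * ∑ᶠ n ∈ {n | n ∈ Sset y x ∧ omegaN n = k}, ((n : ℝ))⁻¹ ∧
          primeProd y x * ∑ᶠ n ∈ {n | n ∈ Sset y x ∧ omegaN n = k}, ((n : ℝ))⁻¹
            ≤ c₂ * LLog x / ((2:ℝ) ^ k * LLog y * Real.sqrt (LLog2 x - LLog2 y)) := by
  obtain ⟨x₀, c, hc, hlow⟩ := low_bound
  obtain ⟨C, hC, hP⟩ := P_est
  refine ⟨x₀, fun B hB => ?_⟩
  set c₁ := Real.exp (-C) * c * (Real.exp (-(B ^ 2 / 2) - 1) / 2) * Real.exp (-1) with hc₁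
  have hc₁0 : 0 < c₁ := by positivity
  refine ⟨c₁, Real.exp (1 + 4 * C) + c₁, hc₁0, by linarith [Real.exp_pos (1 + 4 * C)], ?_⟩
  intro x y k hx hy hyx hLB hk hkB
  rw [sum_eq_es]
  have hw : ∀ p : ℕ, 0 ≤ (fun p : ℕ => 1 / (p : ℝ)) p := fun p => by positivity
  have hyx1 := LLog2_one_le y
  set L := LLog2 x - LLog2 y with hL
  have hL2 : 2 ≤ L := by nlinarith
  have hL0 : 0 < L := by linarith
  have hBL : B * Real.sqrt L ≤ L := by
    have h1 : B ≤ Real.sqrt L := Real.le_sqrt_of_sq_le (by nlinarith)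
    calc B * Real.sqrt L ≤ Real.sqrt L * Real.sqrt L := by gcongr
      _ = L := Real.mul_self_sqrt hL0.le
  obtain ⟨k1, k2⟩ := abs_le.1 hkB
  have hLk : L ≤ k := by linarith
  have hk3 : (k : ℝ) ≤ 3 * L := by linarith
  have hsL : 0 < Real.sqrt L := Real.sqrt_pos.2 hL0
  obtain ⟨P1, P2⟩ := abs_le.1 (hP x y hy hyx)
  have hlo := hlow x y k hx hy hyx hL2 hLk hk3
  have hup := es_upper (fun p : ℕ => 1 / (p : ℝ)) hw (ps y x) k
  have pl := primeProd_lower y x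
  have pu := primeProd_upper y x
  have hes := es_nonneg (fun p : ℕ => 1 / (p : ℝ)) hw (ps y x) k
  have hP0 : 0 ≤ ∑ p ∈ ps y x, 1 / (p : ℝ) := Finset.sum_nonneg fun p _ => hw p
  set P := ∑ p ∈ ps y x, 1 / (p : ℝ) with hPdef
  set e := es (fun p => 1 / (p : ℝ)) (ps y x) k with he
  have hLy : 0 < LLog y := by linarith [LLog_one_le y]
  have hLx : LLog x = Real.exp (LLog2 x) := LLog_eq_exp (by linarith)
  have r1 : Real.exp L ≤ LLog x / LLog y := by
    rw [le_div_iff₀ hLy, hLx]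
    calc Real.exp L * LLog y ≤ Real.exp L * Real.exp (LLog2 y) := by gcongr; exact LLog_le_exp y
      _ = Real.exp (LLog2 x) := by rw [← Real.exp_add, hL]; congr 1; ring
  have r2 : LLog x / LLog y ≤ Real.exp (L + 1) := by
    rw [div_le_iff₀ hLy, hLx]
    calc Real.exp (LLog2 x) = Real.exp (L + 1) * Real.exp (LLog2 y - 1) := by
          rw [← Real.exp_add, hL]; congr 1; ring
      _ ≤ _ := by gcongr; exact exp_le_LLog y
  have form : ∀ a : ℝ, a * LLog x / (2 ^ k * LLog y * Real.sqrt L)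
      = a * ((LLog x / LLog y) / (2 ^ k * Real.sqrt L)) := by
    intro a; field_simp
  rw [form, form]
  constructor
  · have s := stir_lower k hk L B hL0 (by linarith) hkB
    have h1 : Real.exp (-C - L) ≤ primeProd y x :=
      le_trans (Real.exp_le_exp.2 (by linarith)) pl
    calc c₁ * ((LLog x / LLog y) / (2 ^ k * Real.sqrt L))
        ≤ c₁ * (Real.exp (L + 1) / (2 ^ k * Real.sqrt L)) := by gcongr
      _ = Real.exp (-C - L) * (c * (Real.exp (-(B ^ 2 / 2) - 1) / 2 * (Real.exp (2 * L) / (2 ^ k * Real.sqrt L)))) := by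
          have e1 : Real.exp (-1) * Real.exp (L + 1) = Real.exp (-L) * Real.exp (2 * L) := by
            rw [← Real.exp_add, ← Real.exp_add]; congr 1; ring
          rw [hc₁, sub_eq_add_neg (-C) L, Real.exp_add (-C)]
          linear_combination (Real.exp (-C) * c * (Real.exp (-(B ^ 2 / 2) - 1) / 2) / (2 ^ k * Real.sqrt L)) * e1
      _ ≤ Real.exp (-C - L) * (c * (L ^ k / k.factorial)) := by gcongr
      _ ≤ Real.exp (-C - L) * e := by gcongr
      _ ≤ primeProd y x * e := by gcongr
  · have s := stir_upper k hk L hL0 hLk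
    have h1 : primeProd y x ≤ Real.exp (1 + C - L) :=
      le_trans pu (Real.exp_le_exp.2 (by linarith))
    have h2 : P ^ k ≤ Real.exp (3 * C) * L ^ k := by
      have h3 : P ≤ L * Real.exp (C / L) := by
        have := Real.add_one_le_exp (C / L)
        calc P ≤ L * (C / L + 1) := by
              have : L * (C / L + 1) = C + L := by field_simp
              linarith
          _ ≤ _ := by gcongr
      have h4 := pow_le_pow_left₀ hP0 h3 k
      rw [mul_pow, ← Real.exp_nat_mul] at h4
      have h5 : (k : ℝ) * (C / L) ≤ 3 * C := by
        calc (k : ℝ) * (C / L) ≤ (3 * L) * (C / L) := by gcongr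
          _ = 3 * C := by field_simp
      calc P ^ k ≤ L ^ k * Real.exp (k * (C / L)) := h4
        _ ≤ L ^ k * Real.exp (3 * C) := by gcongr
        _ = _ := mul_comm _ _
    calc primeProd y x * e ≤ Real.exp (1 + C - L) * (P ^ k / k.factorial) := by gcongr
      _ ≤ Real.exp (1 + C - L) * (Real.exp (3 * C) * L ^ k / k.factorial) := by gcongr
      _ = Real.exp (1 + C - L) * Real.exp (3 * C) * (L ^ k / k.factorial) := by ring
      _ ≤ Real.exp (1 + C - L) * Real.exp (3 * C) * (Real.exp (2 * L) / (2 ^ k * Real.sqrt L)) := by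
          gcongr
      _ = Real.exp (1 + 4 * C) * (Real.exp L / (2 ^ k * Real.sqrt L)) := by
          have e1 : Real.exp (1 + C - L) * Real.exp (3 * C) * Real.exp (2 * L)
              = Real.exp (1 + 4 * C) * Real.exp L := by
            rw [← Real.exp_add, ← Real.exp_add, ← Real.exp_add]; congr 1; ring
          rw [← mul_div_assoc, ← mul_div_assoc, e1]
      _ ≤ (Real.exp (1 + 4 * C) + c₁) * ((LLog x / LLog y) / (2 ^ k * Real.sqrt L)) := by
          gcongr
          linarith
end

section
/- For every ε ∈ (0, 1/2) there exist C = C(ε) > 0 and x₀ = x₀(ε) such that the following holds for all x ≥ x₀. Let r be an integer with (1+ε)·Log₂ x ≤ r ≤ (2−ε)·Log₂ x and set α := r/Log₂ x − 1. For n ∈ S_{<x}, let M(n) be the maximum of τ(n_{<y})/Log y over those y ∈ 𝒴 for which log(n_{<y}) > 10·(Log₃ x)·Log y, with M(n) := 0 if no such y exists. Then ∏_{p < x}(1 + 1/p)^{-1} · ∑_{n ∈ S_{<x}, ω(n) = r} M(n)/n ≤ C/(Log₂ x)^9. -/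
open Filter Topology
open scoped Classical

lemma aux_mertens1 (N : ℕ) (hN : 1 ≤ N) :
    ∑ p ∈ (Finset.Icc 1 N).filter Nat.Prime, Real.log p / p ≤ Real.log N + Real.log 4 := by
  have hNpos : (0:ℝ) < N := by exact_mod_cast hN
  have h1 : ∑ p ∈ (Finset.Icc 1 N).filter Nat.Prime, (((N / p : ℕ) : ℝ)) * Real.log p
      ≤ N * Real.log N := by
    calc ∑ p ∈ (Finset.Icc 1 N).filter Nat.Prime, (((N / p : ℕ) : ℝ)) * Real.log p
        = ∑ p ∈ (Finset.Icc 1 N).filter Nat.Prime,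
            ∑ n ∈ (Finset.Icc 1 N).filter (fun n => p ∣ n), Real.log p := by
          apply Finset.sum_congr rfl
          intro p _
          rw [Finset.sum_const, nsmul_eq_mul]
          congr 2
          rw [← Nat.Ioc_filter_dvd_card_eq_div]
          rfl
      _ = ∑ n ∈ Finset.Icc 1 N, ∑ p ∈ n.primeFactors, Real.log p := by
          apply Finset.sum_comm'
          intro p n
          simp only [Finset.mem_filter, Finset.mem_Icc, Nat.mem_primeFactors]
          constructor
          · rintro ⟨⟨_, hp⟩, ⟨h1, h2⟩, hd⟩
            exact ⟨⟨hp, hd, by omega⟩, h1, h2⟩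
          · rintro ⟨⟨hp, hd, h0⟩, h1, h2⟩
            exact ⟨⟨⟨hp.one_le, (Nat.le_of_dvd h1 hd).trans h2⟩, hp⟩, ⟨h1, h2⟩, hd⟩
      _ ≤ ∑ n ∈ Finset.Icc 1 N, Real.log N := by
          apply Finset.sum_le_sum
          intro n hn
          rw [Finset.mem_Icc] at hn
          rw [← Real.log_prod (fun p hp => by
            have := (Nat.prime_of_mem_primeFactors hp).pos
            positivity)]
          have hpos : 0 < ∏ p ∈ n.primeFactors, p :=
            Finset.prod_pos fun p hp => (Nat.prime_of_mem_primeFactors hp).pos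
          rw [← Nat.cast_prod]
          apply Real.log_le_log (by exact_mod_cast hpos)
          exact_mod_cast (Nat.le_of_dvd hn.1 (Nat.prod_primeFactors_dvd n)).trans hn.2
      _ = N * Real.log N := by simp
  have h2 : ∑ p ∈ (Finset.Icc 1 N).filter Nat.Prime, Real.log p ≤ Real.log 4 * N := by
    have := Chebyshev.theta_le_log4_mul_x (x := N) hNpos.le
    rw [Chebyshev.theta_eq_sum_primesLE_log] at this
    refine le_trans (le_of_eq ?_) this
    apply Finset.sum_congr _ (fun _ _ => rfl)
    ext p
    simp only [Finset.mem_filter, Finset.mem_Icc, Nat.mem_primesLE]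
    constructor
    · rintro ⟨⟨_, h⟩, hp⟩; exact ⟨h, hp⟩
    · rintro ⟨h, hp⟩; exact ⟨⟨hp.one_le, h⟩, hp⟩
  have h3 : N * ∑ p ∈ (Finset.Icc 1 N).filter Nat.Prime, Real.log p / p
      ≤ N * (Real.log N + Real.log 4) := by
    calc N * ∑ p ∈ (Finset.Icc 1 N).filter Nat.Prime, Real.log p / p
        ≤ ∑ p ∈ (Finset.Icc 1 N).filter Nat.Prime,
          ((((N / p : ℕ) : ℝ)) * Real.log p + Real.log p) := by
          rw [Finset.mul_sum]
          apply Finset.sum_le_sum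
          intro p hp
          have hp' := (Finset.mem_filter.1 hp).2
          have : (N : ℝ) / p ≤ ((N / p : ℕ) : ℝ) + 1 := by
            rw [← Nat.floor_div_eq_div (K := ℝ)]
            exact (Nat.lt_floor_add_one _).le
          have hl : 0 ≤ Real.log p := Real.log_natCast_nonneg p
          calc (N:ℝ) * (Real.log p / p) = (N / p) * Real.log p := by ring
            _ ≤ (((N / p : ℕ) : ℝ) + 1) * Real.log p := by gcongr
            _ = _ := by ring
      _ ≤ _ := by
          rw [Finset.sum_add_distrib]
          linarith
  exact le_of_mul_le_mul_left h3 hNpos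

lemma aux_zeta_partial (σ : ℝ) (hσ : 0 < σ) (N : ℕ) :
    ∑ n ∈ Finset.range (N + 1), ((n + 1 : ℕ) : ℝ) ^ (-(1 + σ)) ≤
      1 + (1 - ((N + 1 : ℕ) : ℝ) ^ (-σ)) / σ := by
  induction N with
  | zero => simp
  | succ k ih =>
    rw [Finset.sum_range_succ]
    set a : ℝ := ((k + 1 : ℕ) : ℝ) with ha
    have ha0 : 0 < a := by rw [ha]; positivity
    have hb : ((k + 1 + 1 : ℕ) : ℝ) = a + 1 := by rw [ha]; push_cast; ring
    rw [hb]
    have key : (a + 1) ^ (-(1 + σ)) ≤ (a ^ (-σ) - (a + 1) ^ (-σ)) / σ := by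
      rw [le_div_iff₀ hσ]
      have e1 : (a + 1) ^ (-(1 + σ)) = (a + 1) ^ (-σ) / (a + 1) := by
        rw [show -(1 + σ) = -σ - 1 by ring, Real.rpow_sub_one (by positivity)]
      have e2 : a ^ (-σ) = (a + 1) ^ (-σ) * (a / (a + 1)) ^ (-σ) := by
        rw [← Real.mul_rpow (by positivity) (by positivity)]
        congr 1
        field_simp
      have e3 : 1 + σ / (a + 1) ≤ (a / (a + 1)) ^ (-σ) := by
        rw [Real.rpow_def_of_pos (by positivity)]
        have l1 : Real.log (a / (a + 1)) ≤ a / (a + 1) - 1 :=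
          Real.log_le_sub_one_of_pos (by positivity)
        have l2 : a / (a + 1) - 1 = - (1 / (a + 1)) := by field_simp; ring
        have l3 := Real.add_one_le_exp (Real.log (a / (a + 1)) * -σ)
        have l4 : σ / (a + 1) = σ * (1 / (a + 1)) := by ring
        nlinarith
      rw [e1, e2]
      have hp : 0 < (a + 1) ^ (-σ) := by positivity
      have : (a + 1) ^ (-σ) * (1 + σ / (a + 1)) ≤ (a + 1) ^ (-σ) * (a / (a + 1)) ^ (-σ) := by
        gcongr
      have h5 : (a + 1) ^ (-σ) / (a + 1) * σ = (a + 1) ^ (-σ) * (σ / (a + 1)) := by ring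
      rw [h5]
      linarith
    have : (1 - (a + 1) ^ (-σ)) / σ = (1 - a ^ (-σ)) / σ + (a ^ (-σ) - (a + 1) ^ (-σ)) / σ := by
      ring
    linarith

noncomputable def auxHom (s : ℝ) (hs : s ≠ 0) : ℕ →* ℝ where
  toFun n := (n : ℝ) ^ (-s)
  map_one' := by simp
  map_mul' a b := by
    push_cast
    exact Real.mul_rpow (by positivity) (by positivity)

lemma aux_tsum_le (σ : ℝ) (hσ : 0 < σ) : ∑' n : ℕ, (n : ℝ) ^ (-(1 + σ)) ≤ 1 + 1 / σ := by
  apply Real.tsum_le_of_sum_range_le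
  · intro n; positivity
  · intro n
    calc ∑ i ∈ Finset.range n, (i : ℝ) ^ (-(1 + σ)) ≤
        ∑ i ∈ Finset.range (n + 1 + 1), (i : ℝ) ^ (-(1 + σ)) := by
          apply Finset.sum_le_sum_of_subset_of_nonneg
          · intro i; simp only [Finset.mem_range]; omega
          · intros; positivity
      _ = ∑ n ∈ Finset.range (n + 1), ((n + 1 : ℕ) : ℝ) ^ (-(1 + σ)) := by
          rw [Finset.sum_range_succ']
          rw [Nat.cast_zero, Real.zero_rpow (by linarith), add_zero]
      _ ≤ _ := aux_zeta_partial σ hσ n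
      _ ≤ _ := by
          have : 0 ≤ ((n + 1 : ℕ) : ℝ) ^ (-σ) := by positivity
          gcongr
          linarith

lemma aux_euler (σ : ℝ) (hσ : 0 < σ) (Q : Finset ℕ) (hQ : ∀ p ∈ Q, p.Prime) :
    Real.exp (∑ p ∈ Q, (p : ℝ) ^ (-(1 + σ))) ≤ 1 + 1 / σ := by
  have hs : (1 + σ) ≠ 0 := by linarith
  have hsum : Summable (auxHom (1 + σ) hs) := by
    have : Summable (fun n : ℕ => (n : ℝ) ^ (-(1 + σ))) :=
      Real.summable_nat_rpow.2 (by linarith)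
    exact this
  have h := EulerProduct.prod_filter_prime_geometric_eq_tsum_factoredNumbers hsum Q
  rw [Finset.filter_true_of_mem hQ] at h
  rw [Real.exp_sum]
  calc ∏ p ∈ Q, Real.exp ((p : ℝ) ^ (-(1 + σ))) ≤ ∏ p ∈ Q, (1 - auxHom (1 + σ) hs p)⁻¹ := by
        apply Finset.prod_le_prod
        · intros; positivity
        · intro p hp
          have hp1 : (1:ℝ) < p := by exact_mod_cast (hQ p hp).one_lt
          have hlt : (p : ℝ) ^ (-(1 + σ)) < 1 := Real.rpow_lt_one_of_one_lt_of_neg hp1 (by linarith)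
          change _ ≤ (1 - (p : ℝ) ^ (-(1 + σ)))⁻¹
          have := Real.add_one_le_exp (-((p : ℝ) ^ (-(1 + σ))))
          rw [le_inv_comm₀ (by positivity) (by linarith), ← Real.exp_neg]
          linarith
    _ = _ := h
    _ ≤ ∑' n : ℕ, auxHom (1 + σ) hs n := by
        apply Summable.tsum_subtype_le
        · intro n; change 0 ≤ (n : ℝ) ^ (-(1 + σ)); positivity
        · exact hsum
    _ ≤ _ := aux_tsum_le σ hσ

lemma aux_sum_log (ℓ : ℝ) (hℓ : 1 ≤ ℓ) (Q : Finset ℕ) (hQ : ∀ p ∈ Q, p.Prime)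
    (hQ' : ∀ p ∈ Q, (p : ℝ) < Real.exp ℓ) :
    ∑ p ∈ Q, Real.log p / p ≤ ℓ * (1 + Real.log 4) := by
  have hN : 1 ≤ ⌊Real.exp ℓ⌋₊ := by
    rw [Nat.one_le_floor_iff]
    exact Real.one_le_exp (by linarith)
  have h4 : 0 ≤ Real.log 4 := Real.log_nonneg (by norm_num)
  calc ∑ p ∈ Q, Real.log p / p ≤
      ∑ p ∈ (Finset.Icc 1 ⌊Real.exp ℓ⌋₊).filter Nat.Prime, Real.log p / p := by
        apply Finset.sum_le_sum_of_subset_of_nonneg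
        · intro p hp
          rw [Finset.mem_filter, Finset.mem_Icc]
          exact ⟨⟨(hQ p hp).one_le, Nat.le_floor (hQ' p hp).le⟩, hQ p hp⟩
        · intro p _ _
          have := Real.log_natCast_nonneg p
          positivity
    _ ≤ _ := aux_mertens1 _ hN
    _ ≤ ℓ + Real.log 4 := by
        have : Real.log (⌊Real.exp ℓ⌋₊ : ℝ) ≤ Real.log (Real.exp ℓ) := by
          apply Real.log_le_log (by exact_mod_cast hN)
          exact Nat.floor_le (Real.exp_pos _).le
        rw [Real.log_exp] at this
        linarith
    _ ≤ _ := by nlinarith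

lemma aux_main_exp : ∃ C : ℝ, 0 < C ∧ ∀ (ℓ : ℝ), 1 ≤ ℓ → ∀ (Q : Finset ℕ), (∀ p ∈ Q, p.Prime) →
    (∀ p ∈ Q, (p : ℝ) < Real.exp ℓ) →
    Real.exp (∑ p ∈ Q, (2 * (p : ℝ) ^ (1 / ℓ) - 1) / p) ≤ C * ℓ := by
  refine ⟨2 * Real.exp (5 * (1 + Real.log 4)), by positivity, ?_⟩
  intro ℓ hℓ Q hQ hQ'
  have hl0 : 0 < ℓ := by linarith
  have hlog := aux_sum_log ℓ hℓ Q hQ hQ'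
  have heul := aux_euler (1 / ℓ) (by positivity) Q hQ
  have hterm : ∀ p ∈ Q, (2 * (p : ℝ) ^ (1 / ℓ) - 1) / p ≤
      (p : ℝ) ^ (-(1 + 1 / ℓ)) + (5 / ℓ) * (Real.log p / p) := by
    intro p hp
    have hp0 : (0:ℝ) < p := by exact_mod_cast (hQ p hp).pos
    set t := Real.log p / ℓ with ht
    have ht0 : 0 ≤ t := by
      have := Real.log_natCast_nonneg p
      positivity
    have ht1 : t ≤ 1 := by
      rw [ht, div_le_one hl0]
      have := Real.log_le_log hp0 (hQ' p hp).le
      rwa [Real.log_exp] at this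
    have e1 : (p : ℝ) ^ (1 / ℓ) = Real.exp t := by
      rw [Real.rpow_def_of_pos hp0, ht]; congr 1; ring
    have e2 : (p : ℝ) ^ (-(1 + 1 / ℓ)) = Real.exp (-t) / p := by
      rw [show -(1 + 1 / ℓ) = -(1/ℓ) - 1 by ring, Real.rpow_sub_one hp0.ne',
        Real.rpow_def_of_pos hp0, ht]
      congr 2; ring
    rw [e1, e2]
    have b1 : Real.exp t ≤ 1 + 2 * t := by
      have := Real.abs_exp_sub_one_sub_id_le (x := t) (by rw [abs_of_nonneg ht0]; exact ht1)
      have := (abs_le.1 this).2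
      nlinarith
    have b2 : 1 - t ≤ Real.exp (-t) := by
      have := Real.add_one_le_exp (-t); linarith
    have e3 : Real.exp (-t) / p + 5 / ℓ * (Real.log p / p) = (Real.exp (-t) + 5 * t) / p := by
      rw [ht]; ring
    rw [e3]
    gcongr
    linarith
  have hs : ∑ p ∈ Q, (2 * (p : ℝ) ^ (1 / ℓ) - 1) / p ≤
      ∑ p ∈ Q, (p : ℝ) ^ (-(1 + 1 / ℓ)) + 5 * (1 + Real.log 4) := by
    refine (Finset.sum_le_sum hterm).trans ?_
    rw [Finset.sum_add_distrib, ← Finset.mul_sum]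
    have : 5 / ℓ * ∑ p ∈ Q, Real.log p / p ≤ 5 / ℓ * (ℓ * (1 + Real.log 4)) := by gcongr
    have e : 5 / ℓ * (ℓ * (1 + Real.log 4)) = 5 * (1 + Real.log 4) := by field_simp
    linarith
  calc _ ≤ Real.exp (∑ p ∈ Q, (p : ℝ) ^ (-(1 + 1 / ℓ)) + 5 * (1 + Real.log 4)) :=
        Real.exp_le_exp.2 hs
    _ ≤ (2 * ℓ) * Real.exp (5 * (1 + Real.log 4)) := by
        rw [Real.exp_add]
        gcongr
        refine heul.trans ?_
        rw [one_div_one_div]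
        linarith
    _ = _ := by ring

noncomputable def auxH (ℓ : ℝ) (p : ℕ) : ℝ := if (p : ℝ) < Real.exp ℓ then 2 * (p : ℝ) ^ (1 / ℓ) else 1

lemma auxH_nonneg (ℓ : ℝ) (p : ℕ) : 0 ≤ auxH ℓ p := by
  unfold auxH; split_ifs <;> positivity

lemma aux_tau (A : Finset ℕ) (hA : ∀ p ∈ A, p.Prime) : (∏ p ∈ A, p).divisors.card = 2 ^ A.card := by
  induction A using Finset.induction_on with
  | empty => simp
  | insert a s ha ih =>
    rw [Finset.prod_insert ha, Finset.card_insert_of_notMem ha, Nat.Coprime.card_divisors_mul,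
      ih (fun p hp => hA p (Finset.mem_insert_of_mem hp)),
      (hA a (Finset.mem_insert_self a s)).divisors, Finset.card_pair]
    · ring
    · exact (hA a (Finset.mem_insert_self a s)).one_lt.ne
    · apply Nat.Coprime.prod_right
      intro p hp
      rw [Nat.coprime_primes (hA a (Finset.mem_insert_self a s)) (hA p (Finset.mem_insert_of_mem hp))]
      rintro rfl
      exact ha hp

lemma aux_pointwise (n : ℕ) (ℓ K : ℝ) (hℓ : 0 < ℓ)
    (h : 10 * K * ℓ < Real.log (nsmall n (Real.exp ℓ))) :
    (tauN (nsmall n (Real.exp ℓ)) : ℝ) / ℓ ≤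
      Real.exp (-(10 * K)) / ℓ * ∏ p ∈ n.primeFactors, auxH ℓ p := by
  set B := n.primeFactors.filter (fun p : ℕ => (p : ℝ) < Real.exp ℓ) with hB
  have hBp : ∀ p ∈ B, p.Prime := fun p hp =>
    Nat.prime_of_mem_primeFactors (Finset.mem_filter.1 hp).1
  have hns : nsmall n (Real.exp ℓ) = ∏ p ∈ B, p := rfl
  have hpos : (0:ℝ) < ((∏ p ∈ B, p : ℕ) : ℝ) := by
    exact_mod_cast Finset.prod_pos fun p hp => (hBp p hp).pos
  have hprod : ∏ p ∈ n.primeFactors, auxH ℓ p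
      = 2 ^ B.card * ((∏ p ∈ B, p : ℕ) : ℝ) ^ (1 / ℓ) := by
    unfold auxH
    rw [← Finset.prod_filter, Finset.prod_mul_distrib, Finset.prod_const, Nat.cast_prod,
      Real.finsetProd_rpow _ _ (fun _ _ => by positivity)]
  rw [hns] at h
  have htau : (tauN (nsmall n (Real.exp ℓ)) : ℝ) = 2 ^ B.card := by
    rw [hns]; unfold tauN; rw [aux_tau B hBp]; push_cast; rfl
  rw [htau, hprod, Real.rpow_def_of_pos hpos]
  set T := Real.log ((∏ p ∈ B, p : ℕ) : ℝ)
  have h1 : 10 * K ≤ T * (1 / ℓ) := by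
    rw [mul_one_div, le_div_iff₀ hℓ]; exact h.le
  have h2 : 1 ≤ Real.exp (-(10 * K)) * Real.exp (T * (1 / ℓ)) := by
    rw [← Real.exp_add]
    exact Real.one_le_exp (by linarith)
  have h3 : (0:ℝ) ≤ 2 ^ B.card / ℓ := by positivity
  calc (2:ℝ) ^ B.card / ℓ = 2 ^ B.card / ℓ * 1 := by ring
    _ ≤ 2 ^ B.card / ℓ * (Real.exp (-(10 * K)) * Real.exp (T * (1 / ℓ))) := by gcongr
    _ = _ := by ring

noncomputable def auxP (x : ℝ) : Finset ℕ :=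
  (Finset.range ⌈x⌉₊).filter (fun p => p.Prime ∧ (p : ℝ) < x)

lemma mem_auxP (x : ℝ) (p : ℕ) : p ∈ auxP x ↔ p.Prime ∧ (p : ℝ) < x := by
  unfold auxP
  rw [Finset.mem_filter, Finset.mem_range]
  constructor
  · exact fun h => h.2
  · exact fun h => ⟨Nat.lt_ceil.2 h.2, h⟩

lemma aux_primeProd (x : ℝ) : primeProd 1 x = ∏ p ∈ auxP x, ((1 : ℝ) + 1 / p)⁻¹ := by
  unfold primeProd
  rw [← finprod_mem_coe_finset]
  congr 1
  ext p
  have : p ∈ {p : ℕ | p.Prime ∧ (1:ℝ) ≤ (p : ℝ) ∧ (p : ℝ) < x} ↔ p ∈ (auxP x : Set ℕ) := by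
    rw [Finset.mem_coe, mem_auxP, Set.mem_setOf_eq]
    constructor
    · rintro ⟨h1, _, h3⟩; exact ⟨h1, h3⟩
    · rintro ⟨h1, h3⟩; exact ⟨h1, by exact_mod_cast h1.one_le, h3⟩
  simp only [this]

lemma aux_expect : ∃ C : ℝ, 0 < C ∧ ∀ (x ℓ : ℝ), 1 ≤ ℓ →
    primeProd 1 x * ∑ A ∈ (auxP x).powerset, ∏ p ∈ A, auxH ℓ p / p ≤ C * ℓ := by
  obtain ⟨C, hC, h⟩ := aux_main_exp
  refine ⟨C, hC, fun x ℓ hℓ => ?_⟩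
  have hl0 : 0 < ℓ := by linarith
  rw [← Finset.prod_one_add, aux_primeProd, ← Finset.prod_mul_distrib]
  refine le_trans ?_ (h ℓ hℓ ((auxP x).filter (fun p : ℕ => (p : ℝ) < Real.exp ℓ))
    (fun p hp => ((mem_auxP x p).1 (Finset.mem_filter.1 hp).1).1)
    (fun p hp => (Finset.mem_filter.1 hp).2))
  rw [Finset.sum_filter, Real.exp_sum]
  apply Finset.prod_le_prod
  · intro p _
    have := auxH_nonneg ℓ p
    positivity
  · intro p hp
    have hp0 : (0:ℝ) < p := by exact_mod_cast ((mem_auxP x p).1 hp).1.pos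
    have hp1 : (1:ℝ) ≤ p := by exact_mod_cast ((mem_auxP x p).1 hp).1.one_le
    unfold auxH
    split_ifs with hlt
    · set a := (p : ℝ) ^ (1 / ℓ)
      have ha : 1 ≤ a := Real.one_le_rpow hp1 (by positivity)
      refine le_trans ?_ (Real.add_one_le_exp _)
      rw [inv_mul_le_iff₀ (by positivity)]
      have h0 : 0 ≤ (2 * a - 1) / p := div_nonneg (by linarith) hp0.le
      have h1 : 0 ≤ 1 / (p:ℝ) := by positivity
      have h2 : 2 * a / p = (2 * a - 1) / p + 1 / p := by ring
      nlinarith [mul_nonneg h1 h0]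
    · rw [Real.exp_zero, inv_mul_cancel₀ (by positivity)]

/-- candidate exponents -/
noncomputable def auxM (α L : ℝ) : Finset ℤ :=
  (Finset.Icc ⌈(α * L - Real.sqrt L) / Real.log 2⌉ ⌊(α * L + Real.sqrt L) / Real.log 2⌋).filter
    (fun m => 1 ≤ m)

lemma auxM_card (α L : ℝ) (hL : 1 ≤ L) : ((auxM α L).card : ℝ) ≤ 5 * L := by
  have h2 : (1/2 : ℝ) < Real.log 2 := by have := Real.log_two_gt_d9; linarith
  have h20 : (0 : ℝ) < Real.log 2 := by linarith
  have hs : Real.sqrt L ≤ L := by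
    rw [Real.sqrt_le_left (by linarith)]; nlinarith
  set a := (α * L - Real.sqrt L) / Real.log 2
  set b := (α * L + Real.sqrt L) / Real.log 2
  have hba : b - a ≤ 4 * L := by
    have : b - a = 2 * Real.sqrt L / Real.log 2 := by simp only [a, b]; ring
    rw [this, div_le_iff₀ h20]
    nlinarith
  have hba0 : 0 ≤ b - a := by
    have : b - a = 2 * Real.sqrt L / Real.log 2 := by simp only [a, b]; ring
    rw [this]; positivity
  have hc : ((auxM α L).card : ℝ) ≤ ((Finset.Icc ⌈a⌉ ⌊b⌋).card : ℝ) := by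
    exact_mod_cast Finset.card_filter_le _ _
  refine hc.trans ?_
  rw [Int.card_Icc]
  have : (((⌊b⌋ + 1 - ⌈a⌉).toNat : ℤ) : ℝ) ≤ b - a + 1 := by
    rw [Int.toNat_eq_max]
    push_cast
    apply max_le
    · have := Int.floor_le b
      have := Int.le_ceil a
      linarith
    · linarith
  have h' : (((⌊b⌋ + 1 - ⌈a⌉).toNat : ℤ) : ℝ) = ((⌊b⌋ + 1 - ⌈a⌉).toNat : ℝ) := by push_cast; rfl
  rw [h'] at this
  linarith

lemma aux_Y (α x y : ℝ) (hy : y ∈ Yset α x) :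
    ∃ m ∈ auxM α (LLog2 x), y = Real.exp ((2:ℝ) ^ m) ∧ LLog y = (2:ℝ) ^ m := by
  obtain ⟨hy0, habs, m, hm⟩ := hy
  have h20 : (1/2 : ℝ) < Real.log 2 := by have := Real.log_two_gt_d9; linarith
  have h21 : Real.log 2 < 1 := by have := Real.log_two_lt_d9; linarith
  have h2p : (0 : ℝ) < Real.log 2 := by linarith
  have h1 : 1 ≤ LLog2 y := le_max_left _ _
  have hm2 : 2 ≤ m := by
    by_contra hcon
    have : m ≤ 1 := by omega
    have : (m : ℝ) ≤ 1 := by exact_mod_cast this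
    nlinarith
  have hm2' : (2:ℝ) ≤ m := by exact_mod_cast hm2
  have hgt : 1 < LLog2 y := by rw [hm]; nlinarith
  have hl : LLog2 y = Real.log (LLog y) := by
    unfold LLog2 at hgt ⊢
    rw [LLog] at hgt ⊢
    rcases le_total 1 (Real.log (LLog y)) with h | h
    · exact max_eq_right h
    · rw [max_eq_left h] at hgt; linarith
  have hLpos : 0 < LLog y := lt_of_lt_of_le one_pos (le_max_left _ _)
  have hLy : LLog y = (2:ℝ) ^ m := by
    rw [← Real.exp_log hLpos, ← hl, hm, ← Real.rpow_intCast, Real.rpow_def_of_pos (by norm_num)]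
    congr 1; ring
  have hLgt : 1 < LLog y := by
    by_contra hcon
    have : Real.log (LLog y) ≤ 0 := Real.log_nonpos hLpos.le (not_lt.1 hcon)
    linarith
  have hlog : LLog y = Real.log y := by
    unfold LLog at hLgt ⊢
    rcases le_total 1 (Real.log y) with h | h
    · exact max_eq_right h
    · rw [max_eq_left h] at hLgt; linarith
  refine ⟨m, ?_, ?_, hLy⟩
  · unfold auxM
    rw [Finset.mem_filter, Finset.mem_Icc]
    rw [hm, abs_le] at habs
    refine ⟨⟨?_, ?_⟩, by omega⟩
    · rw [Int.ceil_le, div_le_iff₀ h2p]; linarith [habs.1]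
    · rw [Int.le_floor, le_div_iff₀ h2p]; linarith [habs.2]
  · rw [← hLy, hlog, Real.exp_log hy0]

theorem statement8 (ε : ℝ) (hε : 0 < ε) (hε' : ε < 1/2) :
    ∃ C : ℝ, 0 < C ∧ ∃ x₀ : ℝ, ∀ x : ℝ, x₀ ≤ x → ∀ r : ℕ,
      (1 + ε) * LLog2 x ≤ r → (r : ℝ) ≤ (2 - ε) * LLog2 x →
      primeProd 1 x * ∑ᶠ n ∈ {n | n ∈ Sset 1 x ∧ omegaN n = r},
          sSup (insert (0:ℝ)
            {t : ℝ | ∃ y ∈ Yset ((r : ℝ) / LLog2 x - 1) x,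
              10 * LLog3 x * LLog y < Real.log (nsmall n y) ∧
                t = (tauN (nsmall n y) : ℝ) / LLog y}) / n
        ≤ C / LLog2 x ^ (9 : ℕ) := by
  obtain ⟨C, hC, hE⟩ := aux_expect
  refine ⟨5 * C, by positivity, 0, ?_⟩
  intro x _ r _ _
  set L := LLog2 x with hLdef
  set α := (r : ℝ) / L - 1
  have hL : 1 ≤ L := le_max_left _ _
  have hL0 : 0 < L := by linarith
  set T : Set ℕ := {n | n ∈ Sset 1 x ∧ omegaN n = r} with hT
  have hsq : ∀ n ∈ T, Squarefree n := fun n hn => hn.1.2.1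
  have hinj : Set.InjOn Nat.primeFactors T := by
    intro a ha b hb hab
    rw [← Nat.prod_primeFactors_of_squarefree (hsq a ha),
      ← Nat.prod_primeFactors_of_squarefree (hsq b hb), hab]
  have hmaps : ∀ n ∈ T, n.primeFactors ∈ (auxP x).powerset := by
    intro n hn
    rw [Finset.mem_powerset]
    intro p hp
    rw [mem_auxP]
    exact ⟨Nat.prime_of_mem_primeFactors hp, (hn.1.2.2 p hp).2⟩
  have hfin : T.Finite := by
    apply Set.Finite.of_finite_image _ hinj
    apply Set.Finite.subset (Finset.finite_toSet (auxP x).powerset)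
    rintro _ ⟨n, hn, rfl⟩
    exact hmaps n hn
  rw [finsum_mem_eq_finite_toFinset_sum _ hfin]
  have hPP : 0 ≤ primeProd 1 x := by
    rw [aux_primeProd]
    exact Finset.prod_nonneg fun p _ => by positivity
  have hexp : Real.exp (-(10 * LLog3 x)) ≤ 1 / L ^ 10 := by
    have h3 : Real.log L ≤ LLog3 x := le_max_right _ _
    rw [Real.exp_neg, ← one_div]
    apply one_div_le_one_div_of_le (by positivity)
    calc L ^ 10 = Real.exp (10 * Real.log L) := by
          rw [show (10:ℝ) = ((10:ℕ):ℝ) by norm_num, Real.exp_nat_mul, Real.exp_log hL0]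
      _ ≤ _ := by gcongr
  have hpt : ∀ n ∈ hfin.toFinset,
      sSup (insert (0:ℝ) {t : ℝ | ∃ y ∈ Yset α x,
              10 * LLog3 x * LLog y < Real.log (nsmall n y) ∧
                t = (tauN (nsmall n y) : ℝ) / LLog y}) / n ≤
      ∑ m ∈ auxM α L, (1 / L ^ 10 / (2:ℝ) ^ m) * ∏ p ∈ n.primeFactors, auxH ((2:ℝ) ^ m) p / p := by
    intro n hn
    rw [Set.Finite.mem_toFinset] at hn
    have hnn : ∀ m ∈ auxM α L,
        0 ≤ (1 / L ^ 10 / (2:ℝ) ^ m) * ∏ p ∈ n.primeFactors, auxH ((2:ℝ) ^ m) p := by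
      intro m _
      have : 0 ≤ ∏ p ∈ n.primeFactors, auxH ((2:ℝ) ^ m) p :=
        Finset.prod_nonneg fun p _ => auxH_nonneg _ _
      positivity
    have hsup : sSup (insert (0:ℝ) {t : ℝ | ∃ y ∈ Yset α x,
              10 * LLog3 x * LLog y < Real.log (nsmall n y) ∧
                t = (tauN (nsmall n y) : ℝ) / LLog y}) ≤
        ∑ m ∈ auxM α L, (1 / L ^ 10 / (2:ℝ) ^ m) * ∏ p ∈ n.primeFactors, auxH ((2:ℝ) ^ m) p := by
      apply csSup_le (Set.insert_nonempty _ _)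
      rintro t (rfl | ⟨y, hy, hlt, rfl⟩)
      · exact Finset.sum_nonneg hnn
      · obtain ⟨m, hm, hye, hLy⟩ := aux_Y α x y hy
        refine le_trans ?_ (Finset.single_le_sum hnn hm)
        rw [hLy] at hlt ⊢
        rw [hye] at hlt ⊢
        refine (aux_pointwise n _ _ (by positivity) hlt).trans ?_
        have : 0 ≤ ∏ p ∈ n.primeFactors, auxH ((2:ℝ) ^ m) p :=
          Finset.prod_nonneg fun p _ => auxH_nonneg _ _
        gcongr
    have hncast : (n : ℝ) = ∏ p ∈ n.primeFactors, (p : ℝ) := by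
      rw [← Nat.cast_prod, Nat.prod_primeFactors_of_squarefree (hsq n hn)]
    calc _ ≤ (∑ m ∈ auxM α L, (1 / L ^ 10 / (2:ℝ) ^ m) *
          ∏ p ∈ n.primeFactors, auxH ((2:ℝ) ^ m) p) / (n : ℝ) := by gcongr
      _ = _ := by
        rw [Finset.sum_div]
        apply Finset.sum_congr rfl
        intro m _
        rw [Finset.prod_div_distrib, ← hncast, mul_div_assoc]
  have hstep : ∀ m ∈ auxM α L, primeProd 1 x * ∑ n ∈ hfin.toFinset,
      (1 / L ^ 10 / (2:ℝ) ^ m) * ∏ p ∈ n.primeFactors, auxH ((2:ℝ) ^ m) p / p ≤ C / L ^ 10 := by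
    intro m hm
    have hm1 : 1 ≤ m := (Finset.mem_filter.1 hm).2
    have h2m : (1:ℝ) ≤ (2:ℝ) ^ m := one_le_zpow₀ (by norm_num) (by omega)
    have hsub : ∑ n ∈ hfin.toFinset, ∏ p ∈ n.primeFactors, auxH ((2:ℝ) ^ m) p / p ≤
        ∑ A ∈ (auxP x).powerset, ∏ p ∈ A, auxH ((2:ℝ) ^ m) p / p := by
      rw [← Finset.sum_image (s := hfin.toFinset) (g := Nat.primeFactors)
        (f := fun A => ∏ p ∈ A, auxH ((2:ℝ) ^ m) p / p) (by rwa [Set.Finite.coe_toFinset])]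
      apply Finset.sum_le_sum_of_subset_of_nonneg
      · intro A hA
        obtain ⟨n, hn, rfl⟩ := Finset.mem_image.1 hA
        exact hmaps n (hfin.mem_toFinset.1 hn)
      · intro A _ _
        exact Finset.prod_nonneg fun p _ => div_nonneg (auxH_nonneg _ _) (by positivity)
    rw [← Finset.mul_sum]
    calc _ = (1 / L ^ 10 / (2:ℝ) ^ m) * (primeProd 1 x *
          ∑ n ∈ hfin.toFinset, ∏ p ∈ n.primeFactors, auxH ((2:ℝ) ^ m) p / p) := by ring
      _ ≤ (1 / L ^ 10 / (2:ℝ) ^ m) * (C * (2:ℝ) ^ m) := by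
          exact mul_le_mul_of_nonneg_left
            ((mul_le_mul_of_nonneg_left hsub hPP).trans (hE x _ h2m)) (by positivity)
      _ = C / L ^ 10 := by
          have : (2:ℝ) ^ m ≠ 0 := by positivity
          field_simp
  calc _ ≤ primeProd 1 x * ∑ n ∈ hfin.toFinset, ∑ m ∈ auxM α L,
        (1 / L ^ 10 / (2:ℝ) ^ m) * ∏ p ∈ n.primeFactors, auxH ((2:ℝ) ^ m) p / p :=
        mul_le_mul_of_nonneg_left (Finset.sum_le_sum hpt) hPP
    _ = ∑ m ∈ auxM α L, primeProd 1 x * ∑ n ∈ hfin.toFinset,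
        (1 / L ^ 10 / (2:ℝ) ^ m) * ∏ p ∈ n.primeFactors, auxH ((2:ℝ) ^ m) p / p := by
        rw [Finset.sum_comm, Finset.mul_sum]
    _ ≤ ∑ m ∈ auxM α L, C / L ^ 10 := Finset.sum_le_sum hstep
    _ = (auxM α L).card * (C / L ^ 10) := by rw [Finset.sum_const, nsmul_eq_mul]
    _ ≤ (5 * L) * (C / L ^ 10) := by
        gcongr
        exact auxM_card α L hL
    _ = 5 * C / L ^ 9 := by field_simp
end
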